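/- Let β > 0, and let f : [0,1]^{d_in×T} → ℝ^{d_out} belong to the Hölder class H^β_{d_in·T, d_out}([0,1]^{d_in×T}, U) (viewing the input as a vector in [0,1]^{d_in·T}). Let d_s be an even positive integer. Then for any positive integers I and J there exists a function φ in the ParaRNN class F^{(T)}_{d_in,d_out,d,d_s,L,U} with depth L = 42(⌊β⌋+1)² I ⌈log₂(8I)⌉ + 6 d_in T and width d = 76(⌊β⌋+1)² 3^{d_in T} d_in^{⌊β⌋+2} d_out T^{⌊β⌋+1} J ⌈log₂(8J)⌉ + d_s (with d divisible by d_s) such that sup over X ∈ [0,1]^{d_in×T} of ‖φ(X) − f(X)‖_∞ ≤ 19 U (⌊β⌋+1)² (d_in T)^{⌊β⌋ + (max(β,1))/2} (JI)^{−2β/(d_in T)}. -/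

import Mathlib

open Matrix MeasureTheory

noncomputable section

/-- The ReLU activation function. -/
def relu (x : ℝ) : ℝ := max x 0

/-- A ParaRNN recurrent layer of width `d`: recurrent weights `Wh`, input weights `Wx`,
bias `b`, and initial hidden state `h0`. -/
structure RecLayer (d : ℕ) where
  Wh : Matrix (Fin d) (Fin d) ℝ
  Wx : Matrix (Fin d) (Fin d) ℝ
  b : Fin d → ℝ
  h0 : Fin d → ℝ

/-- The recurrent matrix is block diagonal with diagonal blocks of size `ds × ds`
(coordinates `i` and `j` interact only if they lie in the same block `⌊i/ds⌋ = ⌊j/ds⌋`). -/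
def RecLayer.BlockDiag {d : ℕ} (ds : ℕ) (ℓ : RecLayer d) : Prop :=
  ∀ i j : Fin d, (i : ℕ) / ds ≠ (j : ℕ) / ds → ℓ.Wh i j = 0

/-- Hidden states of a recurrent layer on the (0-indexed) input sequence `u`:
`state 0 = h0` and `state (t+1) = ReLU (Wh ⬝ state t + Wx ⬝ u t + b)`. -/
def RecLayer.state {d : ℕ} (ℓ : RecLayer d) (u : ℕ → Fin d → ℝ) : ℕ → Fin d → ℝ
  | 0 => ℓ.h0
  | t + 1 => fun i => relu (ℓ.Wh.mulVec (RecLayer.state ℓ u t) i + ℓ.Wx.mulVec (u t) i + ℓ.b i)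

/-- The output sequence of a recurrent layer: position `t` (0-indexed) carries the hidden
state after consuming inputs `u 0, …, u t`. -/
def RecLayer.out {d : ℕ} (ℓ : RecLayer d) (u : ℕ → Fin d → ℝ) : ℕ → Fin d → ℝ :=
  fun t => ℓ.state u (t + 1)

/-- A deep ParaRNN `N = Q ∘ F ∘ R_L ∘ ⋯ ∘ R_1 ∘ P` with input dimension `din`, output
dimension `dout`, width `d`, block size `ds`, and depth `L`. -/
structure ParaNet (din dout d ds L : ℕ) where
  P : Matrix (Fin d) (Fin din) ℝ
  layer : Fin L → RecLayer d
  blockdiag : ∀ l, (layer l).BlockDiag ds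
  Wf : Matrix (Fin d) (Fin d) ℝ
  bf : Fin d → ℝ
  Q : Matrix (Fin dout) (Fin d) ℝ

/-- Sequential application of a list of recurrent layers. -/
def applyLayers {d : ℕ} (ls : List (RecLayer d)) (u : ℕ → Fin d → ℝ) : ℕ → Fin d → ℝ :=
  ls.foldl (fun v ℓ => ℓ.out v) u

/-- The output sequence of a deep ParaRNN on a (0-indexed) input sequence: position `t`
is the paper's output `N(X)[t+1]`. -/
def ParaNet.forward {din dout d ds L : ℕ} (net : ParaNet din dout d ds L)
    (X : ℕ → Fin din → ℝ) : ℕ → Fin dout → ℝ :=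
  fun t => net.Q.mulVec fun i =>
    relu ((net.Wf.mulVec
        (applyLayers (List.ofFn net.layer) (fun s => net.P.mulVec (X s)) t)) i + net.bf i)

/-- Extend a length-`T` input sequence by zero; the ParaRNN output at positions `< T` only
depends on the first `T` inputs. -/
def extendInput {din T : ℕ} (X : Fin T → Fin din → ℝ) : ℕ → Fin din → ℝ :=
  fun t => if h : t < T then X ⟨t, h⟩ else 0

/-- `sup_{X ∈ ℝ^{din×T}, 1 ≤ t ≤ T} ‖N(X)[t]‖_∞ ≤ U`. -/
def ParaNet.Bounded {din dout d ds L : ℕ} (net : ParaNet din dout d ds L)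
    (T : ℕ) (U : ℝ) : Prop :=
  ∀ (X : Fin T → Fin din → ℝ) (t : ℕ), t < T → ∀ i, |net.forward (extendInput X) t i| ≤ U

/-- The ParaRNN function class `F^{(T)}_{din,dout,d,ds,L,U}`: maps `X ↦ N(X)[T]` for deep
ParaRNNs `N` with all outputs bounded by `U` in sup norm. -/
def ParaClass (din dout d ds L T : ℕ) (U : ℝ) :
    Set ((Fin T → Fin din → ℝ) → Fin dout → ℝ) :=
  {f | ∃ net : ParaNet din dout d ds L, net.Bounded T U ∧
        ∀ X, f X = net.forward (extendInput X) (T - 1)}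

/-- The scalar-output ParaRNN class `F^{(T)}_{din,1,d,ds,L,U}`, with outputs in `ℝ`. -/
def scalarClass (din d ds L T : ℕ) (U : ℝ) : Set ((Fin T → Fin din → ℝ) → ℝ) :=
  {f | ∃ net : ParaNet din 1 d ds L, net.Bounded T U ∧
        ∀ X, f X = net.forward (extendInput X) (T - 1) 0}

end
noncomputable section

/-- The unit cube `[0,1]^{din×T}` inside `ℝ^{din×T}`. -/
def cube (T din : ℕ) : Set (Fin T → Fin din → ℝ) :=
  {X | ∀ t i, X t i ∈ Set.Icc (0 : ℝ) 1}

/-- The coordinate basis vector of `ℝ^{din×T}` in direction `c = (t, i)`. -/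
def coordVec {T din : ℕ} (c : Fin T × Fin din) : Fin T → Fin din → ℝ :=
  Pi.single c.1 (Pi.single c.2 1)

/-- Iterated directional derivative (within a set `Ω`) along a list of directions. -/
def dirDerivList {E : Type*} [NormedAddCommGroup E] [NormedSpace ℝ E]
    (Ω : Set E) : List E → (E → ℝ) → E → ℝ
  | [], f => f
  | v :: l, f => fun x => fderivWithin ℝ (dirDerivList Ω l f) Ω x v

/-- The canonical list of coordinate directions associated to a multi-index `n`: each
coordinate `c` repeated `n c` times. -/
def dirsOf {T din : ℕ} {k : ℕ} (n : Fin T × Fin din → Fin (k + 1)) :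
    List (Fin T → Fin din → ℝ) :=
  (Finset.univ.toList (α := Fin T × Fin din)).foldr
    (fun c acc => List.replicate (n c : ℕ) (coordVec c) ++ acc) []

/-- Membership in the Hölder class `H^β_{din·T, dout}([0,1]^{din×T}, M)`: writing
`β = k + ω` with `k ∈ ℕ₀` and `ω ∈ (0,1]`, all partial derivatives up to order `k` exist
and are bounded, the order-`k` partial derivatives are `ω`-Hölder continuous, and for each
component the sum of the sup norms of the partial derivatives of order `< β` plus the sum
of the `ω`-Hölder seminorms of the order-`k` partial derivatives is at most `M`. -/
def MemHolderClass (T din dout : ℕ) (β M : ℝ)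
    (f : (Fin T → Fin din → ℝ) → Fin dout → ℝ) : Prop :=
  ∃ (k : ℕ) (ω : ℝ), β = k + ω ∧ ω ∈ Set.Ioc (0 : ℝ) 1 ∧
    (∀ (i : Fin dout) (l : List (Fin T × Fin din)), l.length < k → ∀ x ∈ cube T din,
      DifferentiableWithinAt ℝ
        (dirDerivList (cube T din) (l.map coordVec) (fun y => f y i)) (cube T din) x) ∧
    (∀ (i : Fin dout) (l : List (Fin T × Fin din)), l.length ≤ k →
      ∃ C : ℝ, ∀ x ∈ cube T din,
        |dirDerivList (cube T din) (l.map coordVec) (fun y => f y i) x| ≤ C) ∧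
    (∀ (i : Fin dout) (l : List (Fin T × Fin din)), l.length = k →
      ∃ C : ℝ, ∀ x ∈ cube T din, ∀ y ∈ cube T din,
        |dirDerivList (cube T din) (l.map coordVec) (fun z => f z i) x
          - dirDerivList (cube T din) (l.map coordVec) (fun z => f z i) y|
          ≤ C * ‖x - y‖ ^ ω) ∧
    (∀ i : Fin dout,
      (∑ n : Fin T × Fin din → Fin (k + 1),
        if (∑ c, ((n c : ℕ))) ≤ k then
          sSup ((fun x =>
            |dirDerivList (cube T din) (dirsOf n) (fun y => f y i) x|) '' cube T din)
        else 0)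
      + (∑ n : Fin T × Fin din → Fin (k + 1),
        if (∑ c, ((n c : ℕ))) = k then
          sSup {r : ℝ | ∃ x ∈ cube T din, ∃ y ∈ cube T din, x ≠ y ∧
            r = |dirDerivList (cube T din) (dirsOf n) (fun z => f z i) x
                  - dirDerivList (cube T din) (dirsOf n) (fun z => f z i) y|
                / ‖x - y‖ ^ ω}
        else 0) ≤ M)

end

section ReluCalculus

variable {Ω : Type*}

/-- Affine combinations of the functions in `S`. -/
def affSpan (S : Set (Ω → ℝ)) : Submodule ℝ (Ω → ℝ) :=
  Submodule.span ℝ (insert (fun _ => 1) S)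

/-- `Reach W n S S'`: every function in `S'` is an affine combination of the last layer of a
ReLU network with `n` hidden layers of width `W`, fed with affine combinations of `S`. -/
def Reach (W : ℕ) : ℕ → Set (Ω → ℝ) → Set (Ω → ℝ) → Prop
  | 0, S, S' => S' ⊆ affSpan S
  | n + 1, S, S' => ∃ g : Fin W → Ω → ℝ, (∀ j, g j ∈ affSpan S) ∧
      Reach W n (Set.range fun j ω => relu (g j ω)) S'

theorem relu_of_nonneg {x : ℝ} (h : 0 ≤ x) : relu x = x := max_eq_left h

theorem relu_of_nonpos {x : ℝ} (h : x ≤ 0) : relu x = 0 := max_eq_right h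

theorem relu_sub_relu_neg (x : ℝ) : relu x - relu (-x) = x := by
  rcases le_total 0 x with h | h
  · rw [relu_of_nonneg h, relu_of_nonpos (by linarith)]; ring
  · rw [relu_of_nonpos h, relu_of_nonneg (by linarith)]; ring

theorem subset_affSpan (S : Set (Ω → ℝ)) : S ⊆ affSpan S :=
  fun _ h => Submodule.subset_span (Set.mem_insert_of_mem _ h)

theorem const_mem_affSpan (S : Set (Ω → ℝ)) (c : ℝ) : (fun _ => c) ∈ affSpan S := by
  have h : (fun _ : Ω => (1 : ℝ)) ∈ affSpan S := Submodule.subset_span (Set.mem_insert _ _)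
  convert (affSpan S).smul_mem c h using 1
  ext; simp

theorem add_mem_affSpan {S : Set (Ω → ℝ)} {f g : Ω → ℝ} (hf : f ∈ affSpan S)
    (hg : g ∈ affSpan S) : (fun ω => f ω + g ω) ∈ affSpan S := (affSpan S).add_mem hf hg

theorem sub_mem_affSpan {S : Set (Ω → ℝ)} {f g : Ω → ℝ} (hf : f ∈ affSpan S)
    (hg : g ∈ affSpan S) : (fun ω => f ω - g ω) ∈ affSpan S := (affSpan S).sub_mem hf hg

theorem neg_mem_affSpan {S : Set (Ω → ℝ)} {f : Ω → ℝ} (hf : f ∈ affSpan S) :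
    (fun ω => -f ω) ∈ affSpan S := (affSpan S).neg_mem hf

theorem mul_mem_affSpan {S : Set (Ω → ℝ)} {f : Ω → ℝ} (c : ℝ) (hf : f ∈ affSpan S) :
    (fun ω => c * f ω) ∈ affSpan S := (affSpan S).smul_mem c hf

theorem sum_mem_affSpan {S : Set (Ω → ℝ)} {ι : Type*} (s : Finset ι) {f : ι → Ω → ℝ}
    (hf : ∀ i ∈ s, f i ∈ affSpan S) : (fun ω => ∑ i ∈ s, f i ω) ∈ affSpan S := by
  convert (affSpan S).sum_mem hf using 1
  ext; simp

theorem mem_affSpan_congr {S : Set (Ω → ℝ)} {f g : Ω → ℝ} (hf : f ∈ affSpan S)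
    (h : ∀ ω, g ω = f ω) : g ∈ affSpan S := by
  rwa [show g = f from funext h]

theorem affSpan_le {S : Set (Ω → ℝ)} {V : Set (Ω → ℝ)} (h : S ⊆ affSpan V) :
    affSpan S ≤ affSpan V := by
  refine Submodule.span_le.2 (Set.insert_subset ?_ h)
  exact const_mem_affSpan V 1

theorem affSpan_mono {S V : Set (Ω → ℝ)} (h : S ⊆ V) : affSpan S ≤ affSpan V :=
  affSpan_le (h.trans (subset_affSpan V))

namespace Reach

variable {W W' n m : ℕ} {S S' S₁ S₂ : Set (Ω → ℝ)}

theorem weaken (h : Reach W n S S') (hS : S ⊆ affSpan S₁) (hS' : S₂ ⊆ affSpan S') :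
    Reach W n S₁ S₂ := by
  induction n generalizing S S₁ with
  | zero => exact hS'.trans ((affSpan_le h).trans (affSpan_le hS))
  | succ n ih =>
    obtain ⟨g, hg, h⟩ := h
    exact ⟨g, fun j => affSpan_le hS (hg j), ih h (subset_affSpan _)⟩

theorem left (h : Reach W n S S') (hS : S ⊆ affSpan S₁) : Reach W n S₁ S' :=
  h.weaken hS (subset_affSpan _)

theorem right (h : Reach W n S S') (hS' : S₂ ⊆ affSpan S') : Reach W n S S₂ :=
  h.weaken (subset_affSpan _) hS'

theorem of_layer {κ : Type*} [Fintype κ] (hW : Fintype.card κ ≤ W) (g : κ → Ω → ℝ)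
    (hg : ∀ j, g j ∈ affSpan S) (h : Reach W n (Set.range fun j ω => relu (g j ω)) S') :
    Reach W (n + 1) S S' := by
  classical
  let e := Fintype.equivFin κ
  refine ⟨fun i => if h : (i : ℕ) < Fintype.card κ then g (e.symm ⟨i, h⟩) else fun _ => 0,
    fun i => ?_, h.left ?_⟩
  · by_cases h : (i : ℕ) < Fintype.card κ
    · simpa [h] using hg _
    · simpa [h] using const_mem_affSpan S 0
  · rintro _ ⟨j, rfl⟩
    refine subset_affSpan _ ⟨⟨e j, (e j).2.trans_le hW⟩, ?_⟩
    simp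

theorem layer {κ : Type*} [Fintype κ] (hW : Fintype.card κ ≤ W) (g : κ → Ω → ℝ)
    (hg : ∀ j, g j ∈ affSpan S) : Reach W 1 S (Set.range fun j ω => relu (g j ω)) :=
  of_layer hW g hg (subset_affSpan _)

theorem width (h : Reach W n S S') (hW : W ≤ W') : Reach W' n S S' := by
  induction n generalizing S with
  | zero => exact h
  | succ n ih =>
    obtain ⟨g, hg, h⟩ := h
    exact of_layer (by simpa using hW) g hg (ih h)

theorem trans (h : Reach W n S S₁) (h' : Reach W m S₁ S') : Reach W (n + m) S S' := by
  induction n generalizing S with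
  | zero => rw [Nat.zero_add]; exact h'.left h
  | succ n ih =>
    obtain ⟨g, hg, h⟩ := h
    rw [Nat.succ_add]
    exact ⟨g, hg, ih h⟩

theorem iUnion {κ : Type*} [Fintype κ] {T : κ → Set (Ω → ℝ)} (h : ∀ a, Reach W n S (T a)) :
    Reach (Fintype.card κ * W) n S (⋃ a, T a) := by
  have key : ∀ S : κ → Set (Ω → ℝ), (∀ a, Reach W n (S a) (T a)) →
      Reach (Fintype.card κ * W) n (⋃ a, S a) (⋃ a, T a) := by
    clear h
    induction n with
    | zero =>
      intro S h
      exact Set.iUnion_subset fun a => Set.Subset.trans (h a) (affSpan_mono (Set.subset_iUnion S a))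
    | succ n ih =>
      intro S h
      choose g hg h using h
      refine of_layer (κ := κ × Fin W) (by simp) (fun p => g p.1 p.2)
        (fun p => affSpan_mono (Set.subset_iUnion S p.1) (hg p.1 p.2))
        ((ih _ h).left (Set.Subset.trans ?_ (subset_affSpan _)))
      refine Set.iUnion_subset fun a => ?_
      rintro _ ⟨j, rfl⟩
      exact ⟨(a, j), rfl⟩
  exact (key (fun _ => S) h).left ((Set.iUnion_subset fun _ => subset_affSpan S))

theorem union (h₁ : Reach W n S S₁) (h₂ : Reach W' n S S₂) :
    Reach (W + W') n S (S₁ ∪ S₂) := by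
  have key : ∀ T T', Reach W n T S₁ → Reach W' n T' S₂ →
      Reach (W + W') n (T ∪ T') (S₁ ∪ S₂) := by
    clear h₁ h₂
    induction n with
    | zero =>
      intro T T' h h'
      exact Set.union_subset (Set.Subset.trans h (affSpan_mono Set.subset_union_left))
        (Set.Subset.trans h' (affSpan_mono Set.subset_union_right))
    | succ n ih =>
      rintro T T' ⟨g, hg, h⟩ ⟨g', hg', h'⟩
      refine of_layer (κ := Fin W ⊕ Fin W') (by simp) (Sum.elim g g') ?_
        ((ih _ _ h h').left (Set.Subset.trans ?_ (subset_affSpan _)))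
      · rintro (j | j)
        · exact affSpan_mono Set.subset_union_left (hg j)
        · exact affSpan_mono Set.subset_union_right (hg' j)
      · rintro _ (⟨j, rfl⟩ | ⟨j, rfl⟩)
        · exact ⟨Sum.inl j, rfl⟩
        · exact ⟨Sum.inr j, rfl⟩
  exact (key S S h₁ h₂).left (Set.union_subset (subset_affSpan S) (subset_affSpan S))

theorem carry {κ : Type*} [Fintype κ] (n : ℕ) (p : κ → Ω → ℝ) (hp : ∀ q, p q ∈ affSpan S) :
    Reach (2 * Fintype.card κ) n S (Set.range p) := by
  induction n with
  | zero => rintro _ ⟨q, rfl⟩; exact hp q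
  | succ n ih =>
    refine ih.trans ((layer (κ := κ ⊕ κ) (by simp [two_mul]) (Sum.elim p fun q ω => -p q ω)
      ?_).right ?_)
    · rintro (q | q)
      · exact subset_affSpan _ ⟨q, rfl⟩
      · exact neg_mem_affSpan (subset_affSpan _ ⟨q, rfl⟩)
    · rintro _ ⟨q, rfl⟩
      have h := sub_mem_affSpan
        (subset_affSpan (Set.range fun (j : κ ⊕ κ) (ω : Ω) =>
          relu (Sum.elim p (fun q ω => -p q ω) j ω)) ⟨Sum.inl q, rfl⟩)
        (subset_affSpan _ ⟨Sum.inr q, rfl⟩)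
      exact mem_affSpan_congr h fun ω => (relu_sub_relu_neg (p q ω)).symm

theorem carry_one (n : ℕ) {p : Ω → ℝ} (hp : p ∈ affSpan S) : Reach 2 n S {p} := by
  simpa using carry (κ := Unit) n (fun _ => p) (fun _ => hp)

/-- A network defined on a subset of the inputs extends to all inputs. -/
theorem lift {Ω₀ : Type*} (ρ : Ω₀ → Ω) {S₀ : Set (Ω₀ → ℝ)}
    (h : Reach W n ((fun f => f ∘ ρ) '' S) S₀) :
    ∃ S', Reach W n S S' ∧ S₀ ⊆ (fun f => f ∘ ρ) '' S' := by
  have key : ∀ (S : Set (Ω → ℝ)) (f : Ω₀ → ℝ), f ∈ affSpan ((fun f => f ∘ ρ) '' S) →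
      ∃ g ∈ affSpan S, f = g ∘ ρ := by
    intro S f hf
    have : affSpan ((fun f => f ∘ ρ) '' S) ≤ (affSpan S).map (LinearMap.funLeft ℝ ℝ ρ) := by
      refine Submodule.span_le.2 (Set.insert_subset ?_ ?_)
      · exact ⟨fun _ => 1, const_mem_affSpan S 1, rfl⟩
      · rintro _ ⟨g, hg, rfl⟩
        exact ⟨g, subset_affSpan S hg, rfl⟩
    obtain ⟨g, hg, rfl⟩ := this hf
    exact ⟨g, hg, rfl⟩
  induction n generalizing S with
  | zero =>
    refine ⟨affSpan S, subset_rfl, fun f hf => ?_⟩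
    obtain ⟨g, hg, rfl⟩ := key S f (h hf)
    exact ⟨g, hg, rfl⟩
  | succ n ih =>
    obtain ⟨g, hg, h⟩ := h
    choose G hG hgG using fun j => key S (g j) (hg j)
    have : (Set.range fun j ω => relu (g j ω)) =
        (fun f => f ∘ ρ) '' (Set.range fun j ω => relu (G j ω)) := by
      rw [← Set.range_comp]
      congr 1
      ext j ω
      simp [hgG j]
    rw [this] at h
    obtain ⟨S', hS', hsub⟩ := ih h
    exact ⟨S', ⟨G, hG, hS'⟩, hsub⟩

end Reach

end ReluCalculus

section Interpolation

/-- Slope changes of the piecewise linear interpolant of `y` at the natural numbers. -/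
noncomputable def slopeChange (y : ℕ → ℝ) (j : ℕ) : ℝ :=
  (y (j + 1) - y j) - if j = 0 then 0 else y j - y (j - 1)

theorem sum_slopeChange_mul (y : ℕ → ℝ) (z : ℝ) (i : ℕ) :
    ∑ j ∈ Finset.range (i + 1), slopeChange y j * (z - j) =
      y i + (z - i) * (y (i + 1) - y i) - y 0 := by
  induction i with
  | zero => simp [slopeChange]; ring
  | succ i ih =>
    rw [Finset.sum_range_succ, ih]
    simp [slopeChange]
    ring

theorem interpolant_eq (y : ℕ → ℝ) {M i : ℕ} (hi : i < M) {z : ℝ} (h₁ : (i : ℝ) ≤ z)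
    (h₂ : z ≤ i + 1) :
    y 0 + ∑ j ∈ Finset.range M, slopeChange y j * relu (z - j) =
      y i + (z - i) * (y (i + 1) - y i) := by
  have h : ∑ j ∈ Finset.range M, slopeChange y j * relu (z - j) =
      ∑ j ∈ Finset.range (i + 1), slopeChange y j * (z - j) := by
    rw [← Finset.sum_subset (Finset.range_mono (Nat.succ_le_of_lt hi))]
    · refine Finset.sum_congr rfl fun j hj => ?_
      have : (j : ℝ) ≤ i := by exact_mod_cast Nat.lt_succ_iff.1 (Finset.mem_range.1 hj)
      rw [relu_of_nonneg (by linarith)]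
    · intro j _ hj
      have : (i : ℝ) + 1 ≤ j := by
        exact_mod_cast Nat.le_of_not_lt fun h => hj (Finset.mem_range.2 h)
      rw [relu_of_nonpos (by linarith), mul_zero]
  rw [h, sum_slopeChange_mul]
  ring

end Interpolation

namespace Reach

variable {Ω : Type*} {W n m : ℕ} {S S' : Set (Ω → ℝ)}

theorem accum {κ : Type*} [Fintype κ] {z : Ω → ℝ} (hz : z ∈ affSpan S) (c : κ → ℕ → ℝ)
    (t : ℕ → ℝ) (N m : ℕ) :
    Reach (N + 2 * (Fintype.card κ + 1)) m S (insert z (Set.range fun q ω =>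
      ∑ j ∈ Finset.range (N * m), c q j * relu (z ω - t j))) := by
  induction m with
  | zero =>
    refine Set.insert_subset hz ?_
    rintro _ ⟨q, rfl⟩
    simpa using const_mem_affSpan S 0
  | succ m ih =>
    refine ih.trans ?_
    set V := insert z (Set.range fun q ω =>
      ∑ j ∈ Finset.range (N * m), c q j * relu (z ω - t j)) with hV
    have hzV : z ∈ affSpan V := subset_affSpan V (Set.mem_insert _ _)
    let p : Option κ → Ω → ℝ := fun o => o.elim z fun q ω =>
      ∑ j ∈ Finset.range (N * m), c q j * relu (z ω - t j)
    have hp : ∀ o, p o ∈ affSpan V := by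
      rintro (_ | q)
      · exact hzV
      · exact subset_affSpan V (Set.mem_insert_of_mem _ ⟨q, rfl⟩)
    have h₁ := layer (S := V) (W := N) (κ := Fin N) (by simp)
      (fun r ω => z ω - t (N * m + r)) (fun r => sub_mem_affSpan hzV (const_mem_affSpan V _))
    have h₂ := h₁.union (carry 1 p hp)
    rw [Fintype.card_option] at h₂
    refine h₂.right (Set.insert_subset (subset_affSpan _ (Or.inr ⟨none, rfl⟩)) ?_)
    rintro _ ⟨q, rfl⟩
    refine mem_affSpan_congr (add_mem_affSpan (subset_affSpan _ (Or.inr ⟨some q, rfl⟩))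
      (sum_mem_affSpan (Finset.univ : Finset (Fin N)) fun r _ =>
        mul_mem_affSpan (c q (N * m + r)) (subset_affSpan _ (Or.inl ⟨r, rfl⟩)))) fun ω => ?_
    beta_reduce
    rw [Nat.mul_succ, Finset.sum_range_add,
      Finset.sum_range fun x => c q (N * m + x) * relu (z ω - t (N * m + x))]
    rfl

/-- Integer parts away from the jumps. -/
theorem floor {z : Ω → ℝ} (hz : z ∈ affSpan S) (a : Ω → ℕ) {n N m : ℕ} (hn : n ≤ N * m)
    {δ : ℝ} (hδ : 0 < δ) (h₁ : ∀ ω, a ω < n) (h₂ : ∀ ω, (a ω : ℝ) ≤ z ω)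
    (h₃ : ∀ ω, a ω + 1 < n → z ω ≤ a ω + 1 - δ) :
    Reach (2 * (N + 4)) m S {z, fun ω => (a ω : ℝ)} := by
  let c : ℕ → ℝ := fun j => if j + 1 < n then 1 / δ else 0
  have h := (accum (κ := Unit) hz (fun _ => c) (fun j => (j : ℝ) + 1 - δ) N m).union
    (accum (κ := Unit) hz (fun _ => c) (fun j => (j : ℝ) + 1) N m)
  simp only [Fintype.card_unit] at h
  refine (h.width (by omega)).right (Set.insert_subset
    (subset_affSpan _ (Or.inl (Set.mem_insert _ _))) (Set.singleton_subset_iff.2 ?_))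
  refine mem_affSpan_congr (sub_mem_affSpan
    (subset_affSpan _ (Or.inl (Set.mem_insert_of_mem _ ⟨(), rfl⟩)))
    (subset_affSpan _ (Or.inr (Set.mem_insert_of_mem _ ⟨(), rfl⟩)))) fun ω => ?_
  rw [← Finset.sum_sub_distrib]
  have key : ∀ j ∈ Finset.range (N * m), c j * relu (z ω - ((j : ℝ) + 1 - δ)) -
      c j * relu (z ω - ((j : ℝ) + 1)) = if j < a ω then 1 else 0 := by
    intro j _
    by_cases hj : j < a ω
    · have hjn : j + 1 < n := lt_of_le_of_lt hj (h₁ ω)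
      have hja : (j : ℝ) + 1 ≤ a ω := by exact_mod_cast hj
      have := h₂ ω
      rw [relu_of_nonneg (by linarith), relu_of_nonneg (by linarith)]
      simp only [c, hjn, hj, if_true]
      field_simp
      ring
    · by_cases hjn : j + 1 < n
      · have hja : (a ω : ℝ) ≤ j := by exact_mod_cast not_lt.1 hj
        have := h₃ ω (by omega)
        rw [relu_of_nonpos (by linarith), relu_of_nonpos (by linarith)]
        simp [hj]
      · simp [c, hj, hjn]
  rw [Finset.sum_congr rfl key, Finset.sum_ite, Finset.sum_const_zero, add_zero,
    Finset.sum_const, nsmul_eq_mul, mul_one]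
  have : Finset.filter (fun j => j < a ω) (Finset.range (N * m)) = Finset.range (a ω) := by
    ext j
    have := h₁ ω
    simp
    omega
  rw [this, Finset.card_range]

/-- Two base-`n` digits of `n ^ 2 ξ`, together with its fractional part. -/
theorem digits {ξ : Ω → ℝ} (hξ : ξ ∈ affSpan S) (a b : Ω → ℕ) {n N m : ℕ} (hn : n ≤ N * m)
    {δ : ℝ} (hδ : 0 < δ) (ha : ∀ ω, a ω < n) (hb : ∀ ω, b ω < n)
    (h₁ : ∀ ω, (a ω * n + b ω : ℝ) ≤ n ^ 2 * ξ ω)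
    (h₂ : ∀ ω, a ω * n + b ω + 1 < n ^ 2 → n ^ 2 * ξ ω ≤ a ω * n + b ω + 1 - δ) :
    Reach (2 * N + 10) (m + m) S {fun ω => (a ω : ℝ), fun ω => (b ω : ℝ),
      fun ω => n ^ 2 * ξ ω - (a ω * n + b ω)} := by
  rcases isEmpty_or_nonempty Ω with hΩ | ⟨⟨ω₀⟩⟩
  · have : ∀ f : Ω → ℝ, f ∈ affSpan (∅ : Set (Ω → ℝ)) := fun f => by
      rw [Subsingleton.elim f (fun _ => 0)]; exact const_mem_affSpan _ 0
    refine (carry (κ := Empty) (S := S) (m + m) (fun e => e.elim) (fun e => e.elim)).width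
      (by simp) |>.right fun f _ => affSpan_mono (Set.empty_subset _) (this f)
  have hn0 : 0 < n := (Nat.zero_le _).trans_lt (ha ω₀)
  have hn0' : (0 : ℝ) < n := by exact_mod_cast hn0
  have f₁ : Reach (2 * (N + 4)) m S {fun ω => n * ξ ω, fun ω => (a ω : ℝ)} := by
    refine floor (mul_mem_affSpan _ hξ) a hn (div_pos hδ hn0') ha (fun ω => ?_) fun ω h => ?_
    · have : (a ω : ℝ) * n ≤ (n * ξ ω) * n := by
        have := h₁ ω
        have hb0 : (0 : ℝ) ≤ b ω := Nat.cast_nonneg _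
        nlinarith
      exact le_of_mul_le_mul_right this hn0'
    · have hbn : (b ω : ℝ) + 1 ≤ n := by exact_mod_cast hb ω
      have hlt : a ω * n + b ω + 1 < n ^ 2 := by
        have := hb ω
        nlinarith
      have := h₂ ω hlt
      have h : (n * ξ ω) * n ≤ (a ω + 1 - δ / n) * n := by
        have e : δ / n * n = δ := by field_simp
        nlinarith
      exact le_of_mul_le_mul_right h hn0'
  set V : Set (Ω → ℝ) := {fun ω => n * ξ ω, fun ω => (a ω : ℝ)} with hV
  have hzV : (fun ω => n * ξ ω) ∈ affSpan V := subset_affSpan V (by simp [hV])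
  have haV : (fun ω => (a ω : ℝ)) ∈ affSpan V := subset_affSpan V (by simp [hV])
  have hz₂ : (fun ω => n * (n * ξ ω - a ω)) ∈ affSpan V :=
    mul_mem_affSpan _ (sub_mem_affSpan hzV haV)
  have f₂ : Reach (2 * (N + 4)) m V {fun ω => n * (n * ξ ω - a ω), fun ω => (b ω : ℝ)} := by
    refine floor hz₂ b hn hδ hb (fun ω => ?_) fun ω h => ?_
    · have := h₁ ω
      nlinarith
    · have han : (a ω : ℝ) + 1 ≤ n := by exact_mod_cast ha ω
      have hlt : a ω * n + b ω + 1 < n ^ 2 := by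
        have := ha ω
        nlinarith
      have := h₂ ω hlt
      nlinarith
  have h := (f₁.width (show _ ≤ 2 * N + 10 by omega)).trans
    ((f₂.union (carry_one m haV)).width (show _ ≤ 2 * N + 10 by omega))
  refine h.right ?_
  rintro f (rfl | rfl | rfl)
  · exact subset_affSpan _ (Or.inr rfl)
  · exact subset_affSpan _ (Or.inl (Or.inr rfl))
  · refine mem_affSpan_congr (sub_mem_affSpan (subset_affSpan _ (Or.inl (Or.inl rfl)))
      (subset_affSpan _ (Or.inl (Or.inr rfl)))) fun ω => ?_
    ring

end Reach

section BinaryExpansion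

/-- The number with binary digits `b 0, …, b (r - 1)` after the point. -/
noncomputable def binVal (b : ℕ → ℝ) (r : ℕ) : ℝ :=
  ∑ j ∈ Finset.range r, (1 / 2) ^ (j + 1) * b j

theorem binVal_succ (b : ℕ → ℝ) (r : ℕ) :
    binVal b (r + 1) = (b 0 + binVal (fun j => b (j + 1)) r) / 2 := by
  simp only [binVal, Finset.sum_range_succ' _ r, add_div, Finset.sum_div]
  rw [add_comm]
  congr 1
  · ring
  · exact Finset.sum_congr rfl fun j _ => by ring

theorem binVal_nonneg {b : ℕ → ℝ} (hb : ∀ j, b j = 0 ∨ b j = 1) (r : ℕ) : 0 ≤ binVal b r := by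
  refine Finset.sum_nonneg fun j _ => ?_
  rcases hb j with h | h <;> rw [h] <;> positivity

theorem binVal_le {b : ℕ → ℝ} (hb : ∀ j, b j = 0 ∨ b j = 1) (r : ℕ) :
    binVal b r ≤ 1 - (1 / 2) ^ r := by
  induction r generalizing b with
  | zero => simp [binVal]
  | succ r ih =>
    have h₁ := ih (b := fun j => b (j + 1)) fun j => hb _
    have h₂ : b 0 ≤ 1 := by rcases hb 0 with h | h <;> rw [h] <;> norm_num
    rw [binVal_succ, pow_succ]
    linarith

theorem exists_binVal_approx (r : ℕ) {x : ℝ} (h₀ : 0 ≤ x) (h₁ : x ≤ 1) :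
    ∃ b : ℕ → ℝ, (∀ j, b j = 0 ∨ b j = 1) ∧ |binVal b r - x| ≤ (1 / 2) ^ r := by
  induction r generalizing x with
  | zero =>
    refine ⟨fun _ => 0, fun _ => Or.inl rfl, ?_⟩
    simp [binVal, abs_of_nonneg h₀, h₁]
  | succ r ih =>
    have key : ∀ e : ℝ, (e = 0 ∨ e = 1) → 0 ≤ 2 * x - e → 2 * x - e ≤ 1 →
        ∃ b : ℕ → ℝ, (∀ j, b j = 0 ∨ b j = 1) ∧ |binVal b (r + 1) - x| ≤ (1 / 2) ^ (r + 1) := by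
      intro e he h₀ h₁
      obtain ⟨b, hb, hbx⟩ := ih h₀ h₁
      refine ⟨fun j => if j = 0 then e else b (j - 1), fun j => ?_, ?_⟩
      · by_cases hj : j = 0
        · simpa [hj] using he
        · simpa [hj] using hb _
      · rw [binVal_succ]
        simp only [if_true, Nat.add_sub_cancel, Nat.succ_ne_zero, if_false]
        rw [show (e + binVal b r) / 2 - x = (binVal b r - (2 * x - e)) / 2 by ring, abs_div,
          abs_two, pow_succ]
        linarith
    rcases le_total x (1 / 2) with h | h
    · exact key 0 (Or.inl rfl) (by linarith) (by linarith)
    · exact key 1 (Or.inr rfl) (by linarith) (by linarith)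

end BinaryExpansion

theorem relu_natCast_sub (p i : ℕ) :
    relu ((p : ℝ) - i + 1) - relu ((p : ℝ) - i) = if i ≤ p then 1 else 0 := by
  split_ifs with h
  · have : (i : ℝ) ≤ p := by exact_mod_cast h
    rw [relu_of_nonneg (by linarith), relu_of_nonneg (by linarith)]
    ring
  · have : (p : ℝ) + 1 ≤ i := by exact_mod_cast Nat.lt_of_not_le h
    rw [relu_of_nonpos (by linarith), relu_of_nonpos (by linarith), sub_zero]

namespace Reach

variable {Ω : Type*} {W n m : ℕ} {S S' : Set (Ω → ℝ)}

/-- Reading the bit at a given position of a binary expansion, one bit per two layers. -/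
theorem scan {p : Ω → ℕ} (hp : (fun ω => (p ω : ℝ)) ∈ affSpan S) (hpm : ∀ ω, p ω < m)
    {bit : Ω → ℕ → ℝ} (hbit : ∀ ω i, bit ω i = 0 ∨ bit ω i = 1)
    (hY : (fun ω => binVal (bit ω) m) ∈ affSpan S) :
    Reach 11 (2 * m) S {fun ω => bit ω (p ω)} := by
  let Y : ℕ → Ω → ℝ := fun i ω => binVal (fun j => bit ω (i + j)) (m - i)
  let acc : ℕ → Ω → ℝ := fun i ω => if p ω < i then bit ω (p ω) else 0
  let st : ℕ → Fin 3 → Ω → ℝ := fun i => ![Y i, fun ω => (p ω : ℝ), acc i]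
  have key : ∀ i ≤ m, Reach 11 (2 * i) S (Set.range (st i)) := by
    intro i
    induction i with
    | zero =>
      rintro - _ ⟨j, rfl⟩
      fin_cases j
      · simpa [st, Y] using hY
      · exact hp
      · simpa [st, acc] using const_mem_affSpan S 0
    | succ i ih =>
      intro him
      refine (ih (by omega)).trans (m := 1 + 1) ?_
      set ε : ℝ := (1 / 2) ^ (m + 1) with hε
      have hε0 : 0 < ε := by positivity
      set V := Set.range (st i) with hV
      have hYV : Y i ∈ affSpan V := subset_affSpan V ⟨0, rfl⟩
      have hpV : (fun ω => (p ω : ℝ)) ∈ affSpan V := subset_affSpan V ⟨1, rfl⟩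
      have hstV : ∀ j, st i j ∈ affSpan V := fun j => subset_affSpan V ⟨j, rfl⟩
      let g : Fin 5 → Ω → ℝ := ![fun ω => Y i ω - (1 / 2 - ε), fun ω => Y i ω - 1 / 2,
        fun ω => (p ω - i : ℝ) + 1, fun ω => (p ω - i : ℝ),
        fun ω => (p ω - (i + 1 : ℕ) : ℝ)]
      have hg : ∀ j, g j ∈ affSpan V := by
        intro j
        fin_cases j
        · exact sub_mem_affSpan hYV (const_mem_affSpan V _)
        · exact sub_mem_affSpan hYV (const_mem_affSpan V _)
        · exact add_mem_affSpan (sub_mem_affSpan hpV (const_mem_affSpan V _))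
            (const_mem_affSpan V _)
        · exact sub_mem_affSpan hpV (const_mem_affSpan V _)
        · exact sub_mem_affSpan hpV (const_mem_affSpan V _)
      have f₁ : Reach 11 1 V _ := (layer (W := 5) (by simp) g hg).union (carry 1 (st i) hstV)
      refine f₁.trans ?_
      set V₁ := (Set.range fun j ω => relu (g j ω)) ∪ Set.range (st i) with hV₁
      have hgV : ∀ j, (fun ω => relu (g j ω)) ∈ affSpan V₁ := fun j =>
        subset_affSpan V₁ (Or.inl ⟨j, rfl⟩)
      have hsV : ∀ j, st i j ∈ affSpan V₁ := fun j => subset_affSpan V₁ (Or.inr ⟨j, rfl⟩)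
      have hrec : ∀ ω, Y i ω = (bit ω i + Y (i + 1) ω) / 2 := by
        intro ω
        have : m - i = (m - (i + 1)) + 1 := by omega
        simp only [Y, this, binVal_succ, add_zero]
        congr 3
        funext j
        congr 1
        ring
      have hY0 : ∀ ω, 0 ≤ Y (i + 1) ω := fun ω => binVal_nonneg (fun j => hbit ω _) _
      have hY1 : ∀ ω, Y (i + 1) ω ≤ 1 - 2 * ε := by
        intro ω
        refine (binVal_le (fun j => hbit ω _) _).trans ?_
        have : ((1 : ℝ) / 2) ^ m ≤ (1 / 2) ^ (m - (i + 1)) :=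
          pow_le_pow_of_le_one (by norm_num) (by norm_num) (by omega)
        rw [hε, pow_succ]
        linarith
      have hθ : (fun ω => bit ω i) ∈ affSpan V₁ := by
        refine mem_affSpan_congr (mul_mem_affSpan (1 / ε) (sub_mem_affSpan (hgV 0) (hgV 1)))
          fun ω => ?_
        change bit ω i = 1 / ε * (relu (Y i ω - (1 / 2 - ε)) - relu (Y i ω - 1 / 2))
        have := hY0 ω
        have := hY1 ω
        rw [hrec ω]
        rcases hbit ω i with h | h <;> rw [h]
        · rw [relu_of_nonpos (by linarith), relu_of_nonpos (by linarith)]; simp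
        · rw [relu_of_nonneg (by linarith), relu_of_nonneg (by linarith)]; field_simp; ring
      have hind : (fun ω => if p ω = i then (1 : ℝ) else 0) ∈ affSpan V₁ := by
        refine mem_affSpan_congr (sub_mem_affSpan (sub_mem_affSpan (hgV 2) (hgV 3))
          (sub_mem_affSpan (hgV 3) (hgV 4))) fun ω => ?_
        change _ = (relu ((p ω - i : ℝ) + 1) - relu (p ω - i : ℝ)) -
          (relu (p ω - i : ℝ) - relu (p ω - (i + 1 : ℕ) : ℝ))
        have h := relu_natCast_sub (p ω) (i + 1)
        rw [show (p ω : ℝ) - (i + 1 : ℕ) + 1 = p ω - i by push_cast; ring] at h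
        rw [h, relu_natCast_sub]
        split_ifs <;> first | omega | norm_num
      let st' : Fin 3 → Ω → ℝ := ![fun ω => 2 * Y i ω - bit ω i, fun ω => (p ω : ℝ), acc i]
      have hst' : ∀ j, st' j ∈ affSpan V₁ := by
        intro j
        fin_cases j
        · exact sub_mem_affSpan (mul_mem_affSpan 2 (hsV 0)) hθ
        · exact hsV 1
        · exact hsV 2
      have f₂ := (layer (W := 5) (κ := Unit) (by simp)
        (fun _ ω => (bit ω i + if p ω = i then (1 : ℝ) else 0) - 1)
        (fun _ => sub_mem_affSpan (add_mem_affSpan hθ hind) (const_mem_affSpan V₁ 1))).union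
          (carry 1 st' hst')
      refine Reach.right (S' := _) (W := 11) f₂ ?_
      rintro _ ⟨j, rfl⟩
      fin_cases j
      · refine mem_affSpan_congr (subset_affSpan _ (Or.inr ⟨0, rfl⟩)) fun ω => ?_
        change Y (i + 1) ω = 2 * Y i ω - bit ω i
        rw [hrec ω]
        ring
      · exact subset_affSpan _ (Or.inr ⟨1, rfl⟩)
      · refine mem_affSpan_congr (add_mem_affSpan (subset_affSpan _ (Or.inr ⟨2, rfl⟩))
          (subset_affSpan _ (Or.inl ⟨(), rfl⟩))) fun ω => ?_
        change acc (i + 1) ω = acc i ω + relu ((bit ω i + if p ω = i then (1 : ℝ) else 0) - 1)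
        simp only [acc]
        rcases lt_trichotomy (p ω) i with h | h | h
        · rw [if_pos (by omega), if_pos h, if_neg h.ne, relu_of_nonpos, add_zero]
          rcases hbit ω i with h | h <;> rw [h] <;> norm_num
        · rw [if_pos (by omega), if_neg (by omega), if_pos h, h, relu_of_nonneg]
          · ring
          · rcases hbit ω i with h | h <;> rw [h] <;> norm_num
        · rw [if_neg (by omega), if_neg (by omega), if_neg (by omega), relu_of_nonpos, add_zero]
          rcases hbit ω i with h | h <;> rw [h] <;> norm_num
  refine (key m le_rfl).right (Set.singleton_subset_iff.2 ?_)
  refine mem_affSpan_congr (subset_affSpan _ ⟨2, rfl⟩) fun ω => ?_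
  simp [st, acc, hpm ω]

end Reach

namespace Reach

variable {Ω : Type*} {W n m : ℕ} {S S' : Set (Ω → ℝ)}

/-- Reading one bit of a two-dimensional table. -/
theorem lookup_bit {A B : Ω → ℕ} (hA : (fun ω => (A ω : ℝ)) ∈ affSpan S)
    (hB : (fun ω => (B ω : ℝ)) ∈ affSpan S) {N : ℕ} (hAN : ∀ ω, A ω < N * m)
    (hBN : ∀ ω, B ω < N * m) {θ : ℕ → ℕ → ℝ} (hθ : ∀ i j, θ i j = 0 ∨ θ i j = 1) :
    Reach (4 * N + 15) (3 * m + 2) S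
      {fun ω => (A ω : ℝ), fun ω => (B ω : ℝ), fun ω => θ (A ω) (B ω)} := by
  let y : Fin N → ℕ → ℝ := fun q a => binVal (fun i => θ a (q * m + i)) m
  have hy : ∀ q a, 0 ≤ y q a ∧ y q a ≤ 1 := fun q a =>
    ⟨binVal_nonneg (fun _ => hθ _ _) m, (binVal_le (fun _ => hθ _ _) m).trans
      (sub_le_self _ (by positivity))⟩
  -- the packed rows
  have f₁ : Reach (4 * N + 15) m S (Set.range (Sum.elim (fun q ω => y q (A ω))
      ![fun ω => (A ω : ℝ), fun ω => (B ω : ℝ)])) := by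
    refine (((accum hA (fun q => slopeChange (y q)) (fun j => (j : ℝ)) N m).union
      (carry_one m hB)).width (by simp; omega)).right ?_
    rintro _ ⟨q | j, rfl⟩
    · refine mem_affSpan_congr (add_mem_affSpan (const_mem_affSpan _ (y q 0))
        (subset_affSpan _ (Or.inl (Set.mem_insert_of_mem _ ⟨q, rfl⟩)))) fun ω => ?_
      beta_reduce
      rw [interpolant_eq (y q) (hAN ω) le_rfl (by linarith)]
      simp
    · fin_cases j
      · exact subset_affSpan _ (Or.inl (Set.mem_insert _ _))
      · exact subset_affSpan _ (Or.inr rfl)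
  set V := Set.range (Sum.elim (fun q ω => y q (A ω))
      ![fun ω => (A ω : ℝ), fun ω => (B ω : ℝ)]) with hV
  have hVm : ∀ i, Sum.elim (fun q ω => y q (A ω))
      ![fun ω => (A ω : ℝ), fun ω => (B ω : ℝ)] i ∈ affSpan V := fun i => subset_affSpan V ⟨i, rfl⟩
  have hAV : (fun ω => (A ω : ℝ)) ∈ affSpan V := hVm (Sum.inr 0)
  have hBV : (fun ω => (B ω : ℝ)) ∈ affSpan V := hVm (Sum.inr 1)
  -- selecting the word
  have f₂ : Reach (4 * N + 15) 1 V (Set.range (Sum.elim (fun q ω => y q (A ω))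
      ![fun ω => (A ω : ℝ), fun ω => (B ω : ℝ)]) ∪
      Set.range fun q : Fin N => fun ω => if B ω / m = q then (1 : ℝ) else 0) := by
    refine (((layer (κ := Fin (N + 1) ⊕ Fin (N + 1)) (W := 2 * N + 2) (by simp; omega)
      (Sum.elim (fun j ω => (B ω : ℝ) - (j * m : ℕ) + 1) (fun j ω => (B ω : ℝ) - (j * m : ℕ)))
      (by
        rintro (j | j)
        · exact add_mem_affSpan (sub_mem_affSpan hBV (const_mem_affSpan V _))
            (const_mem_affSpan V _)
        · exact sub_mem_affSpan hBV (const_mem_affSpan V _))).union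
      (carry 1 _ hVm)).width (by simp; omega)).right ?_
    refine Set.union_subset (Set.Subset.trans Set.subset_union_right (subset_affSpan _)) ?_
    rintro _ ⟨q, rfl⟩
    refine mem_affSpan_congr (sub_mem_affSpan (sub_mem_affSpan
      (subset_affSpan _ (Or.inl ⟨Sum.inl q.castSucc, rfl⟩))
      (subset_affSpan _ (Or.inl ⟨Sum.inr q.castSucc, rfl⟩))) (sub_mem_affSpan
      (subset_affSpan _ (Or.inl ⟨Sum.inl q.succ, rfl⟩))
      (subset_affSpan _ (Or.inl ⟨Sum.inr q.succ, rfl⟩)))) fun ω => ?_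
    simp only [Sum.elim_inl, Sum.elim_inr]
    rw [relu_natCast_sub, relu_natCast_sub]
    have hm : 0 < m := by
      rcases Nat.eq_zero_or_pos m with h | h
      · have := hAN ω; simp [h] at this
      · exact h
    have e₁ : ((q.castSucc : Fin (N + 1)) : ℕ) * m ≤ B ω ↔ (q : ℕ) ≤ B ω / m := by
      rw [Nat.le_div_iff_mul_le hm]; rfl
    have e₂ : ((q.succ : Fin (N + 1)) : ℕ) * m ≤ B ω ↔ (q : ℕ) + 1 ≤ B ω / m := by
      rw [Nat.le_div_iff_mul_le hm]; rfl
    simp only [e₁, e₂]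
    split_ifs <;> first | omega | norm_num
  set V₂ := Set.range (Sum.elim (fun q ω => y q (A ω))
      ![fun ω => (A ω : ℝ), fun ω => (B ω : ℝ)]) ∪
      Set.range fun q : Fin N => fun ω => if B ω / m = q then (1 : ℝ) else 0 with hV₂
  have hy₂ : ∀ q, (fun ω => y q (A ω)) ∈ affSpan V₂ := fun q =>
    subset_affSpan V₂ (Or.inl ⟨Sum.inl q, rfl⟩)
  have hA₂ : (fun ω => (A ω : ℝ)) ∈ affSpan V₂ := subset_affSpan V₂ (Or.inl ⟨Sum.inr 0, rfl⟩)
  have hB₂ : (fun ω => (B ω : ℝ)) ∈ affSpan V₂ := subset_affSpan V₂ (Or.inl ⟨Sum.inr 1, rfl⟩)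
  have hI₂ : ∀ q : Fin N, (fun ω => if B ω / m = q then (1 : ℝ) else 0) ∈ affSpan V₂ := fun q =>
    subset_affSpan V₂ (Or.inr ⟨q, rfl⟩)
  have hq : ∀ ω, B ω / m < N := fun ω => Nat.div_lt_of_lt_mul (by rw [mul_comm]; exact hBN ω)
  have hp₂ : (fun ω => ((B ω % m : ℕ) : ℝ)) ∈ affSpan V₂ := by
    refine mem_affSpan_congr (sub_mem_affSpan hB₂ (sum_mem_affSpan Finset.univ fun (q : Fin N) _ =>
      mul_mem_affSpan ((m : ℝ) * (q : ℕ)) (hI₂ q))) fun ω => ?_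
    rw [Finset.sum_eq_single ⟨B ω / m, hq ω⟩]
    · simp only [if_true, mul_one]
      rw [eq_sub_iff_add_eq]
      exact_mod_cast Nat.mod_add_div (B ω) m
    · intro q _ hne
      rw [if_neg (fun h => hne (Fin.ext h.symm)), mul_zero]
    · simp
  have f₃ : Reach (4 * N + 15) 1 V₂ {fun ω => (A ω : ℝ), fun ω => (B ω : ℝ),
      fun ω => ((B ω % m : ℕ) : ℝ), fun ω => y ⟨B ω / m, hq ω⟩ (A ω)} := by
    refine (((layer (κ := Fin N) (W := N) (by simp)
      (fun q ω => (y q (A ω) + if B ω / m = q then (1 : ℝ) else 0) - 1)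
      (fun q => sub_mem_affSpan (add_mem_affSpan (hy₂ q) (hI₂ q)) (const_mem_affSpan _ 1))).union
      (carry (κ := Fin 3) 1 ![fun ω => (A ω : ℝ), fun ω => (B ω : ℝ),
        fun ω => ((B ω % m : ℕ) : ℝ)] (by
          intro j
          fin_cases j
          · exact hA₂
          · exact hB₂
          · exact hp₂))).width (by simp; omega)).right ?_
    rintro _ (rfl | rfl | rfl | rfl)
    · exact subset_affSpan _ (Or.inr ⟨0, rfl⟩)
    · exact subset_affSpan _ (Or.inr ⟨1, rfl⟩)
    · exact subset_affSpan _ (Or.inr ⟨2, rfl⟩)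
    · refine mem_affSpan_congr (sum_mem_affSpan Finset.univ fun (q : Fin N) _ =>
        (subset_affSpan _ (Or.inl ⟨q, rfl⟩))) fun ω => ?_
      rw [Finset.sum_eq_single ⟨B ω / m, hq ω⟩]
      · rw [if_pos rfl, relu_of_nonneg] <;> linarith [(hy ⟨B ω / m, hq ω⟩ (A ω)).1]
      · intro q _ hne
        rw [if_neg (fun h => hne (Fin.ext h.symm)), relu_of_nonpos]
        linarith [(hy q (A ω)).2]
      · simp
  set V₃ : Set (Ω → ℝ) := {fun ω => (A ω : ℝ), fun ω => (B ω : ℝ),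
      fun ω => ((B ω % m : ℕ) : ℝ), fun ω => y ⟨B ω / m, hq ω⟩ (A ω)} with hV₃
  have f₄ : Reach (4 * N + 15) (2 * m) V₃
      {fun ω => (A ω : ℝ), fun ω => (B ω : ℝ), fun ω => θ (A ω) (B ω)} := by
    refine (((scan (S := V₃) (p := fun ω => B ω % m) (m := m)
      (bit := fun ω i => θ (A ω) (B ω / m * m + i))
      (subset_affSpan V₃ (by simp [hV₃])) (fun ω => Nat.mod_lt _ ?_) (fun ω i => hθ _ _)
      (subset_affSpan V₃ (by simp [hV₃, y]))).union
      (carry (κ := Fin 2) (2 * m) ![fun ω => (A ω : ℝ), fun ω => (B ω : ℝ)] (by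
          intro j
          fin_cases j
          · exact subset_affSpan V₃ (by simp [hV₃])
          · exact subset_affSpan V₃ (by simp [hV₃])))).width (by simp)).right ?_
    · rcases Nat.eq_zero_or_pos m with h | h
      · have := hAN ω; simp [h] at this
      · exact h
    · rintro _ (rfl | rfl | rfl)
      · exact subset_affSpan _ (Or.inr ⟨0, rfl⟩)
      · exact subset_affSpan _ (Or.inr ⟨1, rfl⟩)
      · refine mem_affSpan_congr (subset_affSpan _ (Or.inl rfl)) fun ω => ?_
        rw [Nat.div_add_mod']
  have := ((f₁.trans f₂).trans f₃).trans f₄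
  rwa [show m + 1 + 1 + 2 * m = 3 * m + 2 by ring] at this

/-- Approximate reading of a two-dimensional table with entries in `[0, 1]`. -/
theorem lookup {A B : Ω → ℕ} (hA : (fun ω => (A ω : ℝ)) ∈ affSpan S)
    (hB : (fun ω => (B ω : ℝ)) ∈ affSpan S) {N : ℕ} (hAN : ∀ ω, A ω < N * m)
    (hBN : ∀ ω, B ω < N * m) {G : ℕ → ℕ → ℝ} (hG₀ : ∀ i j, 0 ≤ G i j) (hG₁ : ∀ i j, G i j ≤ 1)
    (P s : ℕ) :
    ∃ Γ : Ω → ℝ, (∀ ω, Γ ω ∈ Set.Icc 0 1) ∧ (∀ ω, |Γ ω - G (A ω) (B ω)| ≤ (1 / 2) ^ (P * s)) ∧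
      Reach (P * (4 * N + 17)) (s * (3 * m + 2)) S {Γ} := by
  choose θ hθ hθG using fun i j => exists_binVal_approx (P * s) (hG₀ i j) (hG₁ i j)
  refine ⟨fun ω => binVal (θ (A ω) (B ω)) (P * s), fun ω => ⟨binVal_nonneg (hθ _ _) _,
    (binVal_le (hθ _ _) _).trans (sub_le_self _ (by positivity))⟩, fun ω => hθG _ _, ?_⟩
  have key : ∀ (c : Fin P) (r : ℕ), Reach (4 * N + 17) (r * (3 * m + 2)) S
      {fun ω => (A ω : ℝ), fun ω => (B ω : ℝ), fun ω => ∑ t ∈ Finset.range r,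
        (1 / 2) ^ (c * s + t + 1) * θ (A ω) (B ω) (c * s + t)} := by
    intro c r
    induction r with
    | zero =>
      rw [Nat.zero_mul (3 * m + 2)]
      rintro _ (rfl | rfl | rfl)
      · exact hA
      · exact hB
      · simpa using const_mem_affSpan S 0
    | succ r ih =>
      rw [Nat.succ_mul r]
      refine ih.trans ?_
      set V : Set (Ω → ℝ) := {fun ω => (A ω : ℝ), fun ω => (B ω : ℝ),
        fun ω => ∑ t ∈ Finset.range r,
        (1 / 2) ^ (c * s + t + 1) * θ (A ω) (B ω) (c * s + t)} with hV
      refine ((lookup_bit (S := V) (subset_affSpan V (by simp [hV]))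
        (subset_affSpan V (by simp [hV])) hAN hBN
        (θ := fun i j => θ i j (c * s + r)) (fun i j => hθ i j _)).union
        (carry_one (3 * m + 2) (S := V) (p := fun ω => ∑ t ∈ Finset.range r,
          (1 / 2) ^ (c * s + t + 1) * θ (A ω) (B ω) (c * s + t))
          (subset_affSpan V (by simp [hV])))).right ?_
      rintro _ (rfl | rfl | rfl)
      · exact subset_affSpan _ (Or.inl (by simp))
      · exact subset_affSpan _ (Or.inl (by simp))
      · refine mem_affSpan_congr (add_mem_affSpan (subset_affSpan _ (Or.inr rfl))
          (mul_mem_affSpan ((1 / 2) ^ (c * s + r + 1)) (subset_affSpan _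
            (Or.inl (Or.inr (Or.inr rfl)))))) fun ω => ?_
        rw [Finset.sum_range_succ]
  have := iUnion fun c => key c s
  rw [Fintype.card_fin] at this
  refine this.right (Set.singleton_subset_iff.2 ?_)
  refine mem_affSpan_congr (sum_mem_affSpan Finset.univ fun (c : Fin P) _ => subset_affSpan _
    (Set.mem_iUnion.2 ⟨c, Or.inr (Or.inr rfl)⟩)) fun ω => ?_
  have split : ∀ (h : ℕ → ℝ) (P : ℕ), ∑ i ∈ Finset.range (P * s), h i =
      ∑ c ∈ Finset.range P, ∑ t ∈ Finset.range s, h (c * s + t) := by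
    intro h P
    induction P with
    | zero => simp
    | succ P ih => rw [Nat.succ_mul, Finset.sum_range_add, Finset.sum_range_succ, ih]
  rw [binVal, split, Finset.sum_range]

end Reach

theorem relu_sub_relu_sub_one_mem (z : ℝ) : relu z - relu (z - 1) ∈ Set.Icc (0 : ℝ) 1 := by
  unfold relu
  rcases le_total z 0 with h | h <;> rcases le_total (z - 1) 0 with h' | h' <;>
    simp [h, h'] <;> linarith

theorem abs_relu_sub_relu_sub_one_sub_le (z : ℝ) {c : ℝ} (hc : c ∈ Set.Icc (0 : ℝ) 1) :
    |relu z - relu (z - 1) - c| ≤ |z - c| := by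
  obtain ⟨h₀, h₁⟩ := hc
  unfold relu
  rcases le_total z 0 with h | h <;> rcases le_total (z - 1) 0 with h' | h'
  · simp only [h, h', max_eq_right]
    rw [abs_of_nonpos (by linarith), abs_of_nonpos (by linarith)]
    linarith
  · linarith
  · simp [h, h']
  · simp only [h, h', max_eq_left]
    rw [abs_of_nonneg (by linarith), abs_of_nonneg (by linarith)]
    linarith

namespace Reach

variable {Ω : Type*} {W n m : ℕ} {S S' : Set (Ω → ℝ)}

/-- Approximation of `x (1 - x)` by iterated sawtooth functions. -/
theorem bump {z : Ω → ℝ} (hz : z ∈ affSpan S) (h01 : ∀ ω, z ω ∈ Set.Icc (0 : ℝ) 1)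
    {N L : ℕ} (hN : 0 < N) (hL : 0 < L) (t : ℕ) :
    ∃ Q : Ω → ℝ, (∀ ω, 0 ≤ z ω * (1 - z ω) - Q ω) ∧
      (∀ ω, z ω * (1 - z ω) - Q ω ≤ (1 / ((N * L : ℕ) : ℝ) ^ 2) ^ t / 4) ∧
      Reach (N + 8) (t * L) S {Q} := by
  set M := N * L with hM
  have hM0 : 0 < M := Nat.mul_pos hN hL
  have hMr : (0 : ℝ) < M := by exact_mod_cast hM0
  have key : ∃ v Q : Ω → ℝ, (∀ ω, v ω ∈ Set.Icc (0 : ℝ) 1) ∧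
      (∀ ω, z ω * (1 - z ω) = Q ω + v ω * (1 - v ω) * (1 / (M : ℝ) ^ 2) ^ t) ∧
      Reach (N + 8) (t * L) S {v, Q} := by
    induction t with
    | zero =>
      refine ⟨z, fun _ => 0, h01, fun ω => by simp, ?_⟩
      rw [Nat.zero_mul]
      rintro _ (rfl | rfl)
      · exact hz
      · exact const_mem_affSpan S 0
    | succ t ih =>
      obtain ⟨v, Q, hv, hQ, hr⟩ := ih
      let y₁ : ℕ → ℝ := fun j => if j % 2 = 0 then 0 else 1
      let y₂ : ℕ → ℝ := fun j => (j / M) * (1 - j / M)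
      let y : Fin 2 → ℕ → ℝ := ![y₁, y₂]
      let I : Fin 2 → Ω → ℝ := fun q ω =>
        y q 0 + ∑ j ∈ Finset.range M, slopeChange (y q) j * relu (M * v ω - j)
      have hi : ∀ ω, ∃ i < M, (i : ℝ) ≤ M * v ω ∧ M * v ω ≤ i + 1 := by
        intro ω
        obtain ⟨h₀, h₁⟩ := hv ω
        have hnn : 0 ≤ M * v ω := by positivity
        by_cases hlt : ⌊M * v ω⌋₊ < M
        · exact ⟨_, hlt, Nat.floor_le hnn, (Nat.lt_floor_add_one _).le⟩
        · have hle : (M : ℝ) ≤ M * v ω := (Nat.le_floor_iff hnn).1 (not_lt.1 hlt)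
          have hc : ((M - 1 : ℕ) : ℝ) = M - 1 := by
            rw [Nat.cast_sub hM0, Nat.cast_one]
          refine ⟨M - 1, by omega, ?_, ?_⟩ <;> rw [hc] <;> nlinarith
      have hI : ∀ ω, I 0 ω ∈ Set.Icc (0 : ℝ) 1 ∧
          v ω * (1 - v ω) = I 1 ω + I 0 ω * (1 - I 0 ω) * (1 / (M : ℝ) ^ 2) := by
        intro ω
        obtain ⟨i, hiM, h₁, h₂⟩ := hi ω
        have e₀ : I 0 ω = y₁ i + (M * v ω - i) * (y₁ (i + 1) - y₁ i) :=
          interpolant_eq y₁ hiM h₁ h₂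
        have e₁ : I 1 ω = y₂ i + (M * v ω - i) * (y₂ (i + 1) - y₂ i) :=
          interpolant_eq y₂ hiM h₁ h₂
        have : I 0 ω = M * v ω - i ∨ I 0 ω = 1 - (M * v ω - i) := by
          rw [e₀]
          rcases Nat.mod_two_eq_zero_or_one i with h | h
          · left
            have : (i + 1) % 2 = 1 := by omega
            simp [y₁, h, this]
          · right
            have : (i + 1) % 2 = 0 := by omega
            simp [y₁, h, this]
            ring
        have e₂ : I 0 ω * (1 - I 0 ω) = (M * v ω - i) * (1 - (M * v ω - i)) := by
          rcases this with h | h <;> rw [h] <;> ring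
        refine ⟨?_, ?_⟩
        · rcases this with h | h <;> rw [h] <;> constructor <;> linarith
        · rw [e₂, e₁]
          simp only [y₂]
          push_cast
          field_simp
          ring
      refine ⟨I 0, fun ω => Q ω + (1 / (M : ℝ) ^ 2) ^ t * I 1 ω, fun ω => (hI ω).1, fun ω => ?_, ?_⟩
      · rw [hQ ω, (hI ω).2]
        ring
      · rw [Nat.succ_mul t]
        refine hr.trans ?_
        set V : Set (Ω → ℝ) := {v, Q} with hV
        have hvV : v ∈ affSpan V := subset_affSpan V (by simp [hV])
        have hQV : Q ∈ affSpan V := subset_affSpan V (by simp [hV])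
        have f := (accum (mul_mem_affSpan (M : ℝ) hvV) (fun q => slopeChange (y q))
          (fun j => (j : ℝ)) N L).union (carry_one L hQV)
        refine (f.width (by simp)).right ?_
        rintro _ (rfl | rfl)
        · exact add_mem_affSpan (const_mem_affSpan _ (y 0 0))
            (subset_affSpan _ (Or.inl (Set.mem_insert_of_mem _ ⟨0, rfl⟩)))
        · exact add_mem_affSpan (subset_affSpan _ (Or.inr rfl)) (mul_mem_affSpan _
            (add_mem_affSpan (const_mem_affSpan _ (y 1 0))
              (subset_affSpan _ (Or.inl (Set.mem_insert_of_mem _ ⟨1, rfl⟩)))))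
  obtain ⟨v, Q, hv, hQ, hr⟩ := key
  have hpos : (0 : ℝ) ≤ (1 / (M : ℝ) ^ 2) ^ t := by positivity
  refine ⟨Q, fun ω => ?_, fun ω => ?_, hr.right fun f hf => subset_affSpan _ (Or.inr hf)⟩
  · obtain ⟨h₀, h₁⟩ := hv ω
    rw [hQ ω, add_sub_cancel_left]
    exact mul_nonneg (mul_nonneg h₀ (by linarith)) hpos
  · rw [hQ ω, add_sub_cancel_left]
    nlinarith [sq_nonneg (v ω - 1 / 2)]

/-- Approximate multiplication of two functions with values in `[0, 1]`. -/
theorem prod {x y : Ω → ℝ} (hx : x ∈ affSpan S) (hy : y ∈ affSpan S)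
    (hx01 : ∀ ω, x ω ∈ Set.Icc (0 : ℝ) 1) (hy01 : ∀ ω, y ω ∈ Set.Icc (0 : ℝ) 1)
    {N L : ℕ} (hN : 0 < N) (hL : 0 < L) (t : ℕ) :
    ∃ Z : Ω → ℝ, (∀ ω, Z ω ∈ Set.Icc (0 : ℝ) 1) ∧
      (∀ ω, |Z ω - x ω * y ω| ≤ (1 / ((N * L : ℕ) : ℝ) ^ 2) ^ t / 2) ∧
      Reach (3 * N + 26) (t * L + 1) S {Z} := by
  have hs : (fun ω => 1 / 2 * (x ω + y ω)) ∈ affSpan S := mul_mem_affSpan _ (add_mem_affSpan hx hy)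
  obtain ⟨Q₁, a₁, b₁, r₁⟩ := bump hx hx01 hN hL t
  obtain ⟨Q₂, a₂, b₂, r₂⟩ := bump hy hy01 hN hL t
  obtain ⟨Q₃, a₃, b₃, r₃⟩ := bump hs (fun ω => by
    obtain ⟨h₁, h₂⟩ := hx01 ω
    obtain ⟨h₃, h₄⟩ := hy01 ω
    constructor <;> linarith) hN hL t
  let z : Ω → ℝ := fun ω => 1 / 2 * (x ω + y ω) - 2 * Q₃ ω + 1 / 2 * (Q₁ ω + Q₂ ω)
  have hz01 : ∀ ω, x ω * y ω ∈ Set.Icc (0 : ℝ) 1 := fun ω =>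
    ⟨mul_nonneg (hx01 ω).1 (hy01 ω).1, mul_le_one₀ (hx01 ω).2 (hy01 ω).1 (hy01 ω).2⟩
  refine ⟨fun ω => relu (z ω) - relu (z ω - 1), fun ω => relu_sub_relu_sub_one_mem _, fun ω =>
    (abs_relu_sub_relu_sub_one_sub_le _ (hz01 ω)).trans ?_, ?_⟩
  · have e : z ω - x ω * y ω = 2 * (1 / 2 * (x ω + y ω) * (1 - 1 / 2 * (x ω + y ω)) - Q₃ ω) -
        1 / 2 * ((x ω * (1 - x ω) - Q₁ ω) + (y ω * (1 - y ω) - Q₂ ω)) := by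
      simp only [z]; ring
    have := a₁ ω; have := a₂ ω; have := a₃ ω
    have := b₁ ω; have := b₂ ω; have := b₃ ω
    rw [e, abs_le]
    constructor <;> linarith
  · have f := ((((r₁.union r₂).union r₃).union (carry_one (t * L) hs)).width
      (show _ ≤ 3 * N + 26 by omega))
    refine f.trans ?_
    have hz : z ∈ affSpan ((({Q₁} ∪ {Q₂}) ∪ {Q₃}) ∪ {fun ω => 1 / 2 * (x ω + y ω)}) :=
      add_mem_affSpan (sub_mem_affSpan (subset_affSpan _ (by simp))
        (mul_mem_affSpan _ (subset_affSpan _ (by simp))))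
        (mul_mem_affSpan _ (add_mem_affSpan (subset_affSpan _ (by simp))
          (subset_affSpan _ (by simp))))
    refine (layer (κ := Fin 2) (W := 3 * N + 26) (by simp) ![z, fun ω => z ω - 1] ?_).right ?_
    · intro j
      fin_cases j
      · exact hz
      · exact sub_mem_affSpan hz (const_mem_affSpan _ 1)
    · rintro _ rfl
      exact sub_mem_affSpan (subset_affSpan _ ⟨0, rfl⟩) (subset_affSpan _ ⟨1, rfl⟩)

/-- Approximate monomials. -/
theorem monomial {κ : Type*} [Fintype κ] {u : κ → Ω → ℝ} (hu : ∀ c, u c ∈ affSpan S)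
    (hu01 : ∀ c ω, u c ω ∈ Set.Icc (0 : ℝ) 1) {N L : ℕ} (hN : 0 < N) (hL : 0 < L) (t : ℕ)
    (l : List κ) :
    ∃ Z : Ω → ℝ, (∀ ω, Z ω ∈ Set.Icc (0 : ℝ) 1) ∧
      (∀ ω, |Z ω - (l.map fun c => u c ω).prod| ≤
        l.length * ((1 / ((N * L : ℕ) : ℝ) ^ 2) ^ t / 2)) ∧
      Reach (3 * N + 26 + 2 * Fintype.card κ) (l.length * (t * L + 1)) S (insert Z (Set.range u)) := by
  induction l with
  | nil =>
    refine ⟨fun _ => 1, fun ω => by simp, fun ω => by simp, ?_⟩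
    rw [List.length_nil, Nat.zero_mul (t * L + 1)]
    refine Set.insert_subset (const_mem_affSpan S 1) ?_
    rintro _ ⟨c, rfl⟩
    exact hu c
  | cons c l ih =>
    obtain ⟨Z, h01, he, hr⟩ := ih
    set V := insert Z (Set.range u) with hV
    have huV : ∀ c, u c ∈ affSpan V := fun c =>
      subset_affSpan V (Set.mem_insert_of_mem _ ⟨c, rfl⟩)
    obtain ⟨Z', h01', he', hr'⟩ := prod (huV c) (subset_affSpan V (Set.mem_insert _ _))
      (hu01 c) h01 hN hL t
    refine ⟨Z', h01', fun ω => ?_, ?_⟩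
    · rw [List.map_cons, List.prod_cons, List.length_cons]
      have h₁ : |u c ω * Z ω - u c ω * (l.map fun c => u c ω).prod| ≤
          |Z ω - (l.map fun c => u c ω).prod| := by
        rw [← mul_sub, abs_mul, abs_of_nonneg (hu01 c ω).1]
        exact mul_le_of_le_one_left (abs_nonneg _) (hu01 c ω).2
      have h₂ := abs_sub_le (Z' ω) (u c ω * Z ω) (u c ω * (l.map fun c => u c ω).prod)
      have := he ω
      have := he' ω
      rw [Nat.cast_succ]
      linarith
    · rw [List.length_cons, Nat.succ_mul l.length]
      refine hr.trans ((hr'.union (carry _ u huV)).right ?_)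
      exact Set.Subset.trans (Set.insert_subset (Or.inl rfl) Set.subset_union_right)
        (subset_affSpan _)

/-- Approximate monomials and their products with a coefficient. -/
theorem coeff_monomial {κ : Type*} [Fintype κ] {u : κ → Ω → ℝ} (hu : ∀ c, u c ∈ affSpan S)
    (hu01 : ∀ c ω, u c ω ∈ Set.Icc (0 : ℝ) 1) {Γ : Ω → ℝ} (hΓ : Γ ∈ affSpan S)
    (hΓ01 : ∀ ω, Γ ω ∈ Set.Icc (0 : ℝ) 1) {N L : ℕ} (hN : 0 < N) (hL : 0 < L) (t : ℕ)
    (l : List κ) :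
    ∃ Z Z' : Ω → ℝ, (∀ ω, Z ω ∈ Set.Icc (0 : ℝ) 1) ∧
      (∀ ω, |Z ω - (l.map fun c => u c ω).prod| ≤
        l.length * ((1 / ((N * L : ℕ) : ℝ) ^ 2) ^ t / 2)) ∧
      (∀ ω, |Z' ω - Γ ω * Z ω| ≤ (1 / ((N * L : ℕ) : ℝ) ^ 2) ^ t / 2) ∧
      Reach (3 * N + 28 + 2 * Fintype.card κ) ((l.length + 1) * (t * L + 1)) S {Z, Z'} := by
  obtain ⟨Z, h01, he, hr⟩ := monomial (S := S) (u := fun o : Option κ => o.elim Γ u) (by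
    rintro (_ | c)
    exacts [hΓ, hu c]) (by
    rintro (_ | c)
    exacts [hΓ01, hu01 c]) hN hL t (l.map some)
  rw [List.length_map] at hr
  simp only [List.length_map, List.map_map] at he
  set V := insert Z (Set.range fun o : Option κ => o.elim Γ u) with hV
  have hZV : Z ∈ affSpan V := subset_affSpan V (Set.mem_insert _ _)
  obtain ⟨Z', h01', he', hr'⟩ := prod (subset_affSpan V (Set.mem_insert_of_mem _ ⟨none, rfl⟩))
    hZV hΓ01 h01 hN hL t
  refine ⟨Z, Z', h01, he, he', ?_⟩
  rw [Nat.succ_mul l.length]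
  refine (hr.width ?_).trans (((hr'.union (carry_one _ hZV)).width ?_).right ?_)
  · rw [Fintype.card_option]; omega
  · omega
  · rintro _ (rfl | rfl)
    · exact subset_affSpan _ (Or.inr rfl)
    · exact subset_affSpan _ (Or.inl rfl)

end Reach

/-- Encoding a finite vector of digits in a single number. -/
theorem exists_digit_encoding (κ : Type*) [Fintype κ] (n : ℕ) :
    ∃ (e : κ → ℕ) (dec : ℕ → κ → ℕ), ∀ a : κ → ℕ, (∀ c, a c < n) →
      ∑ c, a c * n ^ e c < n ^ Fintype.card κ ∧ dec (∑ c, a c * n ^ e c) = a := by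
  let E := Fintype.equivFin κ
  refine ⟨fun c => E c, fun A c => A / n ^ (E c : ℕ) % n, fun a ha => ?_⟩
  let φ : Fin (Fintype.card κ) → Fin n := fun i => ⟨a (E.symm i), ha _⟩
  have h : ∑ c, a c * n ^ (E c : ℕ) = (finFunctionFinEquiv φ : ℕ) := by
    rw [finFunctionFinEquiv_apply]
    exact Fintype.sum_equiv E _ _ fun c => by simp [φ]
  rw [h]
  refine ⟨Fin.isLt _, funext fun c => ?_⟩
  have : ((finFunctionFinEquiv.symm (finFunctionFinEquiv φ) (E c) : Fin n) : ℕ) = a c := by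
    rw [Equiv.symm_apply_apply]
    simp [φ]
  exact this

namespace Reach

variable {Ω : Type*} {W n m : ℕ} {S S' : Set (Ω → ℝ)}

/-- Approximation of one term of a piecewise polynomial. -/
theorem term {κ : Type*} [Fintype κ] {u : κ → Ω → ℝ} (hu : ∀ c, u c ∈ affSpan S)
    (hu01 : ∀ c ω, u c ω ∈ Set.Icc (0 : ℝ) 1) {a b : Ω → κ → ℕ}
    (ha : ∀ c, (fun ω => (a ω c : ℝ)) ∈ affSpan S) (hb : ∀ c, (fun ω => (b ω c : ℝ)) ∈ affSpan S)
    {M N L k : ℕ} (hN : 0 < N) (hL : 0 < L) (haM : ∀ ω c, a ω c < M) (hbM : ∀ ω c, b ω c < M)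
    (hM : M ^ Fintype.card κ ≤ N * m) {g : (κ → ℕ) → (κ → ℕ) → ℝ}
    (hg : ∀ a b, g a b ∈ Set.Icc (0 : ℝ) 1) (t P s : ℕ) {E : ℝ}
    (hE₁ : (1 / ((N * L : ℕ) : ℝ) ^ 2) ^ t ≤ E) (hE₂ : (1 / 2) ^ (P * s) ≤ E)
    (l : List κ) (hl : l.length ≤ k) :
    ∃ O : Ω → ℝ, (∀ ω, |O ω - (2 * g (a ω) (b ω) - 1) * (l.map fun c => u c ω).prod| ≤
        3 * (k + 1) * E) ∧
      Reach (max (P * (4 * N + 17)) (3 * N + 28) + 2 * Fintype.card κ)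
        (s * (3 * m + 2) + (k + 1) * (t * L + 1)) S {O} := by
  obtain ⟨e, dec, hdec⟩ := exists_digit_encoding κ M
  have hA : (fun ω => ((∑ c, a ω c * M ^ e c : ℕ) : ℝ)) ∈ affSpan S := by
    refine mem_affSpan_congr (sum_mem_affSpan Finset.univ fun c _ =>
      mul_mem_affSpan ((M : ℝ) ^ e c) (ha c)) fun ω => ?_
    push_cast
    exact Finset.sum_congr rfl fun c _ => mul_comm _ _
  have hB : (fun ω => ((∑ c, b ω c * M ^ e c : ℕ) : ℝ)) ∈ affSpan S := by
    refine mem_affSpan_congr (sum_mem_affSpan Finset.univ fun c _ =>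
      mul_mem_affSpan ((M : ℝ) ^ e c) (hb c)) fun ω => ?_
    push_cast
    exact Finset.sum_congr rfl fun c _ => mul_comm _ _
  obtain ⟨Γ, hΓ01, hΓ, rΓ⟩ := lookup hA hB (fun ω => (hdec _ (haM ω)).1.trans_le hM)
    (fun ω => (hdec _ (hbM ω)).1.trans_le hM) (G := fun i j => g (dec i) (dec j))
    (fun i j => (hg _ _).1) (fun i j => (hg _ _).2) P s
  simp only [(hdec _ (haM _)).2, (hdec _ (hbM _)).2] at hΓ
  have f₁ := (rΓ.union (carry (s * (3 * m + 2)) u hu))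
  set V := {Γ} ∪ Set.range u with hV
  obtain ⟨Z, Z', hZ01, hZ, hZ', rZ⟩ := coeff_monomial (S := V)
    (fun c => subset_affSpan V (Or.inr ⟨c, rfl⟩)) hu01 (subset_affSpan V (Or.inl rfl)) hΓ01
    hN hL t l
  refine ⟨fun ω => 2 * Z' ω - Z ω, fun ω => ?_, ?_⟩
  · set p := (l.map fun c => u c ω).prod
    set ρ := (1 / ((N * L : ℕ) : ℝ) ^ 2) ^ t
    set γ := g (a ω) (b ω)
    have hlk : (l.length : ℝ) ≤ k := by exact_mod_cast hl
    have hρ0 : 0 ≤ ρ := by positivity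
    have h₁ : |Z ω - p| ≤ k * (E / 2) := (hZ ω).trans (by gcongr)
    have h₂ : |γ * (Z ω - p)| ≤ k * (E / 2) := by
      rw [abs_mul, abs_of_nonneg (hg _ _).1]
      exact (mul_le_of_le_one_left (abs_nonneg _) (hg _ _).2).trans h₁
    have h₃ : |(Γ ω - γ) * Z ω| ≤ E := by
      rw [abs_mul, abs_of_nonneg (hZ01 ω).1]
      exact (mul_le_of_le_one_right (abs_nonneg _) (hZ01 ω).2).trans ((hΓ ω).trans hE₂)
    have h₄ := hZ' ω
    have hk : (0 : ℝ) ≤ k * E := mul_nonneg (Nat.cast_nonneg _) (hρ0.trans hE₁)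
    rw [show 2 * Z' ω - Z ω - (2 * γ - 1) * p = 2 * (Z' ω - Γ ω * Z ω) + 2 * ((Γ ω - γ) * Z ω) +
      2 * (γ * (Z ω - p)) - (Z ω - p) by ring]
    rw [abs_le] at *
    constructor <;> linarith [h₁.1, h₁.2, h₂.1, h₂.2, h₃.1, h₃.2, h₄.1, h₄.2]
  · refine (f₁.width (by gcongr; exact le_max_left _ _)).trans ?_
    have hd : (k + 1) * (t * L + 1) =
        (l.length + 1) * (t * L + 1) + (k - l.length) * (t * L + 1) := by
      rw [← Nat.add_mul]; congr 1; omega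
    rw [hd]
    refine (rZ.width (by gcongr; exact le_max_right _ _)).trans ?_
    refine (carry_one _ ?_).width (by omega)
    exact sub_mem_affSpan (mul_mem_affSpan 2 (subset_affSpan _ (by simp)))
      (subset_affSpan _ (by simp))

/-- Approximation of a piecewise polynomial away from the boundaries of the pieces. -/
theorem piecewise_poly {κ ι : Type*} [Fintype κ] [Fintype ι] {ξ : κ → Ω → ℝ}
    (hξ : ∀ c, ξ c ∈ affSpan S) {a b : Ω → κ → ℕ}
    {M N L k : ℕ} (hN : 0 < N) (hL : 0 < L) (haM : ∀ ω c, a ω c < M) (hbM : ∀ ω c, b ω c < M)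
    (hM : M ^ Fintype.card κ ≤ N * m) (hM' : M ≤ N * m) {δ : ℝ} (hδ : 0 < δ)
    (h₁ : ∀ ω c, (a ω c * M + b ω c : ℝ) ≤ M ^ 2 * ξ c ω)
    (h₂ : ∀ ω c, a ω c * M + b ω c + 1 < M ^ 2 → M ^ 2 * ξ c ω ≤ a ω c * M + b ω c + 1 - δ)
    (h₃ : ∀ ω c, M ^ 2 * ξ c ω ≤ a ω c * M + b ω c + 1)
    {g : ι → (κ → ℕ) → (κ → ℕ) → ℝ} (hg : ∀ i a b, g i a b ∈ Set.Icc (0 : ℝ) 1) (t P s : ℕ) {E : ℝ}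
    (hE₁ : (1 / ((N * L : ℕ) : ℝ) ^ 2) ^ t ≤ E) (hE₂ : (1 / 2) ^ (P * s) ≤ E)
    (l : ι → List κ) (hl : ∀ i, (l i).length ≤ k) (q : ι → ℝ) {U : ℝ} (hq : ∀ i, |q i| ≤ U)
    (hW₁ : Fintype.card κ * (2 * N + 10) ≤ W)
    (hW₂ : Fintype.card ι * (max (P * (4 * N + 17)) (3 * N + 28) + 2 * Fintype.card κ) ≤ W) :
    ∃ O : Ω → ℝ, (∀ ω, |O ω - ∑ i, q i * ((2 * g i (a ω) (b ω) - 1) *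
        ((l i).map fun c => (M : ℝ) ^ 2 * ξ c ω - (a ω c * M + b ω c)).prod)| ≤
        Fintype.card ι * (U * (3 * (k + 1) * E))) ∧
      Reach W (m + m + (s * (3 * m + 2) + (k + 1) * (t * L + 1))) S {O} := by
  let u : κ → Ω → ℝ := fun c ω => (M : ℝ) ^ 2 * ξ c ω - (a ω c * M + b ω c)
  have f₁ := (iUnion fun c => digits (hξ c) (fun ω => a ω c) (fun ω => b ω c) hM' hδ
    (fun ω => haM ω c) (fun ω => hbM ω c) (fun ω => h₁ ω c) (fun ω => h₂ ω c)).width hW₁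
  set V : Set (Ω → ℝ) := ⋃ c, {fun ω => (a ω c : ℝ), fun ω => (b ω c : ℝ), u c} with hV
  have hterm := fun i => term (S := V) (u := u) (a := a) (b := b) (k := k)
    (fun c => subset_affSpan V (Set.mem_iUnion.2 ⟨c, by simp⟩))
    (fun c ω => ⟨by simpa [u] using h₁ ω c, by simpa [u, add_comm] using h₃ ω c⟩)
    (fun c => subset_affSpan V (Set.mem_iUnion.2 ⟨c, by simp⟩))
    (fun c => subset_affSpan V (Set.mem_iUnion.2 ⟨c, by simp⟩)) hN hL haM hbM hM (hg i)
    t P s hE₁ hE₂ (l i) (hl i)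
  choose O hO rO using hterm
  have hE0 : 0 ≤ E := le_trans (by positivity) hE₁
  refine ⟨fun ω => ∑ i, q i * O i ω, fun ω => ?_, f₁.trans
    (((iUnion rO).width hW₂).right (Set.singleton_subset_iff.2 ?_))⟩
  · rw [← Finset.sum_sub_distrib]
    refine (Finset.abs_sum_le_sum_abs _ _).trans ?_
    rw [Fintype.card, ← nsmul_eq_mul]
    refine Finset.sum_le_card_nsmul _ _ _ fun i _ => ?_
    rw [← mul_sub, abs_mul]
    exact mul_le_mul (hq i) (hO i ω) (abs_nonneg _) ((abs_nonneg _).trans (hq i))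
  · exact sum_mem_affSpan _ fun i _ => mul_mem_affSpan _
      (subset_affSpan _ (Set.mem_iUnion.2 ⟨i, rfl⟩))

end Reach

section DirectionalDerivatives

variable {E : Type*} [NormedAddCommGroup E] [NormedSpace ℝ E] {s : Set E} {F : E → ℝ}

theorem contDiffOn_dirDerivList (hs : UniqueDiffOn ℝ s) {n : ℕ} (l : List E)
    (hF : ContDiffOn ℝ (n + l.length : ℕ) F s) : ContDiffOn ℝ n (dirDerivList s l F) s := by
  induction l generalizing n with
  | nil => exact hF
  | cons v l ih =>
    have h : ContDiffOn ℝ (n + 1 : ℕ) (dirDerivList s l F) s := ih (by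
      rwa [show n + 1 + l.length = n + (v :: l).length by simp; ring])
    exact (h.fderivWithin hs (m := n) (by norm_cast)).clm_apply contDiffOn_const

/-- Mixed partial derivatives do not depend on the order of differentiation. -/
theorem dirDerivList_perm (hs : UniqueDiffOn ℝ s) (hs' : s ⊆ closure (interior s)) {k : ℕ}
    (hF : ContDiffOn ℝ k F s) {l₁ l₂ : List E} (h : l₁.Perm l₂) (hl : l₁.length ≤ k) :
    ∀ x ∈ s, dirDerivList s l₁ F x = dirDerivList s l₂ F x := by
  induction h with
  | nil => exact fun _ _ => rfl
  | cons v h ih =>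
    intro x hx
    have ih := ih (by simp at hl; omega)
    simp only [dirDerivList]
    rw [fderivWithin_congr ih (ih x hx)]
  | swap v w l =>
    intro x hx
    have hg : ContDiffOn ℝ (2 : ℕ) (dirDerivList s l F) s :=
      contDiffOn_dirDerivList hs l (hF.of_le (by simp at hl; norm_cast; omega))
    have hd : DifferentiableWithinAt ℝ (fderivWithin ℝ (dirDerivList s l F) s) s x :=
      (hg.fderivWithin hs (m := 1) (by norm_cast)).differentiableOn (by norm_num) x hx
    have e : ∀ v w, fderivWithin ℝ (fun y => fderivWithin ℝ (dirDerivList s l F) s y w) s x v =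
        fderivWithin ℝ (fderivWithin ℝ (dirDerivList s l F) s) s x v w := by
      intro v w
      rw [fderivWithin_clm_apply (hs x hx) hd (differentiableWithinAt_const w)]
      simp
    have hsymm := (hg x hx).isSymmSndFDerivWithinAt (by simp) hs (hs' hx) hx
    change fderivWithin ℝ (fun y => fderivWithin ℝ (dirDerivList s l F) s y v) s x w =
      fderivWithin ℝ (fun y => fderivWithin ℝ (dirDerivList s l F) s y w) s x v
    rw [e, e]
    exact hsymm w v
  | trans h₁ _ ih₁ ih₂ =>
    intro x hx
    rw [ih₁ hl x hx, ih₂ (h₁.length_eq ▸ hl) x hx]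

theorem contDiffOn_of_dirDerivList [FiniteDimensional ℝ E] (hs : UniqueDiffOn ℝ s) {κ : Type*}
    [Fintype κ] {e : κ → E} (he : ∀ y, ∃ a : κ → ℝ, y = ∑ c, a c • e c) {k : ℕ}
    (hd : ∀ l : List κ, l.length < k → DifferentiableOn ℝ (dirDerivList s (l.map e) F) s)
    (hc : ∀ l : List κ, l.length = k → ContinuousOn (dirDerivList s (l.map e) F) s) :
    ContDiffOn ℝ k F s := by
  have key : ∀ (n : ℕ) (l : List κ), l.length + n = k →
      ContDiffOn ℝ n (dirDerivList s (l.map e) F) s := by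
    intro n
    induction n with
    | zero =>
      intro l hl
      rw [Nat.cast_zero, contDiffOn_zero]
      exact hc l hl
    | succ n ih =>
      intro l hl
      rw [Nat.cast_succ, contDiffOn_succ_iff_fderivWithin hs]
      refine ⟨hd l (by omega), by simp, contDiffOn_clm_apply.2 fun y => ?_⟩
      obtain ⟨a, rfl⟩ := he y
      simp only [map_sum, map_smul]
      exact ContDiffOn.sum fun c _ => (ih (c :: l) (by simp; omega)).const_smul (a c)
  exact key k [] (by simp)

end DirectionalDerivatives

section Taylor

theorem abs_sub_taylor_le {k : ℕ} {H : ℕ → ℝ → ℝ} {M : ℝ}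
    (hH : ∀ j < k, ∀ t ∈ Set.Icc (0 : ℝ) 1, HasDerivWithinAt (H j) (H (j + 1) t) (Set.Icc 0 1) t)
    (hM : ∀ t ∈ Set.Icc (0 : ℝ) 1, |H k t - H k 0| ≤ M) :
    ∀ t ∈ Set.Icc (0 : ℝ) 1,
      |H 0 t - ∑ j ∈ Finset.range (k + 1), H j 0 * (t ^ j / j.factorial)| ≤
        M * (t ^ k / k.factorial) := by
  induction k generalizing H with
  | zero => simpa using hM
  | succ k ih =>
    have ih := ih (H := fun j => H (j + 1)) (fun j hj => hH (j + 1) (by omega)) hM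
    have hp : ∀ (j : ℕ) (t : ℝ), HasDerivAt (fun t : ℝ => t ^ (j + 1) / (j + 1).factorial)
        (t ^ j / j.factorial) t := by
      intro j t
      refine ((hasDerivAt_pow (j + 1) t).div_const ((j + 1).factorial : ℝ)).congr_deriv ?_
      rw [Nat.factorial_succ]
      have : (j.factorial : ℝ) ≠ 0 := by positivity
      push_cast
      field_simp
    have hder : ∀ t ∈ Set.Icc (0 : ℝ) 1, HasDerivWithinAt
        (fun t => H 0 t - ∑ j ∈ Finset.range (k + 1 + 1), H j 0 * (t ^ j / j.factorial))
        (H 1 t - ∑ j ∈ Finset.range (k + 1), H (j + 1) 0 * (t ^ j / j.factorial))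
        (Set.Icc 0 1) t := by
      intro t ht
      refine (hH 0 (by omega) t ht).sub ?_
      simp only [Finset.sum_range_succ' _ (k + 1)]
      have h := (HasDerivAt.fun_sum (u := Finset.range (k + 1)) (x := t) fun j _ =>
        (hp j t).const_mul (H (j + 1) 0)).add_const (H 0 0 * (1 / (Nat.factorial 0)))
      simpa using h.hasDerivWithinAt
    have hb := image_norm_le_of_norm_deriv_right_le_deriv_boundary (a := 0) (b := 1)
      (B := fun t => M * (t ^ (k + 1) / (k + 1).factorial))
      (B' := fun t => M * (t ^ k / k.factorial))
      (fun t ht => (hder t ht).continuousWithinAt)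
      (fun t ht => (hder t ⟨ht.1, ht.2.le⟩).mono_of_mem_nhdsWithin (Icc_mem_nhdsGE_of_mem ht))
      (by simp [Finset.sum_range_succ' _ (k + 1)]) (fun t => (hp k t).const_mul M)
      (fun t ht => by simpa using ih t ⟨ht.1, ht.2.le⟩)
    intro t ht
    simpa using hb ht

variable {E : Type*} [NormedAddCommGroup E] [NormedSpace ℝ E] {s : Set E} {F : E → ℝ}

/-- Taylor expansion in terms of iterated directional derivatives. -/
theorem abs_sub_taylor_dirDerivList_le (hs : Convex ℝ s) {κ : Type*} [Fintype κ] {e : κ → E}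
    {k : ℕ} (hd : ∀ l : List κ, l.length < k → DifferentiableOn ℝ (dirDerivList s (l.map e) F) s)
    {x : E} (hx : x ∈ s) {a : κ → ℝ} (hy : x + ∑ c, a c • e c ∈ s) {r : ℝ} (hr : ∀ c, |a c| ≤ r)
    {M : ℝ} (hM : ∀ l : List κ, l.length = k → ∀ t ∈ Set.Icc (0 : ℝ) 1,
      |dirDerivList s (l.map e) F (x + t • ∑ c, a c • e c) -
        dirDerivList s (l.map e) F x| ≤ M) :
    |F (x + ∑ c, a c • e c) - ∑ j ∈ Finset.range (k + 1), ∑ l : Fin j → κ,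
      (1 / j.factorial : ℝ) * (dirDerivList s ((List.ofFn l).map e) F x *
        ((List.ofFn l).map a).prod)| ≤
      Fintype.card κ ^ k * r ^ k * M / k.factorial := by
  set h := ∑ c, a c • e c with hh
  let H : ℕ → ℝ → ℝ := fun j t => ∑ l : Fin j → κ,
    dirDerivList s ((List.ofFn l).map e) F (x + t • h) * ((List.ofFn l).map a).prod
  have hmem : ∀ t ∈ Set.Icc (0 : ℝ) 1, x + t • h ∈ s := fun t ht => by
    have := hs.add_smul_sub_mem hx hy ht
    simpa using this
  have hH : ∀ j < k, ∀ t ∈ Set.Icc (0 : ℝ) 1,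
      HasDerivWithinAt (H j) (H (j + 1) t) (Set.Icc 0 1) t := by
    intro j hj t ht
    have h₁ : ∀ l : Fin j → κ, HasDerivWithinAt
        (fun t : ℝ => dirDerivList s ((List.ofFn l).map e) F (x + t • h))
        (∑ c, a c * dirDerivList s (e c :: (List.ofFn l).map e) F (x + t • h))
        (Set.Icc 0 1) t := by
      intro l
      have hγ : HasDerivWithinAt (fun t : ℝ => x + t • h) h (Set.Icc 0 1) t := by
        simpa using (((hasDerivAt_id t).smul_const h).const_add x).hasDerivWithinAt
      have hD := (hd (List.ofFn l) (by simpa using hj) _ (hmem t ht)).hasFDerivWithinAt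
      have := hD.comp_hasDerivWithinAt t hγ (fun t ht => hmem t ht)
      have e₁ : (fderivWithin ℝ (dirDerivList s ((List.ofFn l).map e) F) s (x + t • h)) h =
          ∑ c, a c * dirDerivList s (e c :: (List.ofFn l).map e) F (x + t • h) := by
        conv_lhs => rw [hh]
        rw [map_sum]
        simp only [map_smul, smul_eq_mul, dirDerivList]
        rfl
      rw [e₁] at this
      exact this
    have h₂ := HasDerivWithinAt.fun_sum (u := Finset.univ) fun (l : Fin j → κ) _ =>
      (h₁ l).mul_const ((List.ofFn l).map a).prod
    refine h₂.congr_deriv ?_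
    simp only [H]
    rw [← (Fin.consEquiv fun _ => κ).sum_comp, Fintype.sum_prod_type, Finset.sum_comm]
    refine Finset.sum_congr rfl fun l _ => ?_
    rw [Finset.sum_mul]
    refine Finset.sum_congr rfl fun c _ => ?_
    simp [List.ofFn_succ, Fin.consEquiv]
    ring
  have hMk : ∀ t ∈ Set.Icc (0 : ℝ) 1, |H k t - H k 0| ≤ Fintype.card κ ^ k * r ^ k * M := by
    intro t ht
    simp only [H, ← Finset.sum_sub_distrib]
    refine (Finset.abs_sum_le_sum_abs _ _).trans ?_
    have hcard : ((Finset.univ : Finset (Fin k → κ)).card : ℝ) = Fintype.card κ ^ k := by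
      rw [Finset.card_univ, Fintype.card_fun, Fintype.card_fin]; push_cast; rfl
    rw [mul_assoc, ← hcard, ← nsmul_eq_mul]
    refine Finset.sum_le_card_nsmul _ _ _ fun l _ => ?_
    rw [← sub_mul, abs_mul, mul_comm]
    have hp : |((List.ofFn l).map a).prod| ≤ r ^ k := by
      rw [List.map_ofFn, List.prod_ofFn, Finset.abs_prod]
      refine (Finset.prod_le_prod (fun i _ => abs_nonneg _) fun i _ => hr (l i)).trans ?_
      simp
    have hm := hM (List.ofFn l) (by simp) t ht
    rw [zero_smul, add_zero]
    exact mul_le_mul hp hm (abs_nonneg _) ((abs_nonneg _).trans hp)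
  have := abs_sub_taylor_le hH hMk 1 (by simp)
  simp only [H, one_smul, zero_smul, add_zero, one_pow] at this
  rw [mul_one_div] at this
  convert this using 3
  · have e0 : ∀ l : Fin 0 → κ, List.ofFn l = [] := fun l => by simp
    simp [dirDerivList]
  · refine Finset.sum_congr rfl fun j _ => ?_
    rw [mul_comm, Finset.mul_sum]

end Taylor

section HolderClass

variable {T din dout : ℕ}

theorem cube_eq_pi : cube T din =
    Set.univ.pi fun _ => Set.univ.pi fun _ => Set.Icc (0 : ℝ) 1 := by
  ext X; simp only [cube, Set.mem_pi, Set.mem_univ, true_imp_iff, Set.mem_ofPred_eq]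

theorem convex_cube : Convex ℝ (cube T din) := by
  rw [cube_eq_pi]
  exact convex_pi fun _ _ => convex_pi fun _ _ => convex_Icc 0 1

theorem uniqueDiffOn_cube : UniqueDiffOn ℝ (cube T din) := by
  rw [cube_eq_pi]
  exact UniqueDiffOn.univ_pi fun _ => UniqueDiffOn.univ_pi fun _ =>
    uniqueDiffOn_Icc zero_lt_one

theorem cube_subset_closure_interior : cube T din ⊆ closure (interior (cube T din)) := by
  rw [convex_cube.closure_interior_eq_closure_of_nonempty_interior]
  · exact subset_closure
  · rw [cube_eq_pi]
    refine ⟨fun _ _ => 1 / 2, ?_⟩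
    simp only [interior_pi_set Set.finite_univ, interior_Icc, Set.mem_pi]
    norm_num

theorem isCompact_cube : IsCompact (cube T din) := by
  rw [cube_eq_pi]
  exact isCompact_univ_pi fun _ => isCompact_univ_pi fun _ => isCompact_Icc

theorem eq_sum_coordVec (y : Fin T → Fin din → ℝ) :
    y = ∑ c : Fin T × Fin din, y c.1 c.2 • coordVec c := by
  ext t i
  rw [Finset.sum_apply, Finset.sum_apply, Finset.sum_eq_single (t, i)]
  · simp [coordVec]
  · rintro ⟨t', i'⟩ - h
    by_cases ht : t' = t
    · subst ht
      have : i ≠ i' := fun h' => h (by rw [h'])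
      simp [coordVec, this]
    · simp [coordVec, Ne.symm ht]
  · simp

theorem sum_count_eq_length {α : Type*} [Fintype α] [BEq α] [LawfulBEq α] (l : List α) :
    ∑ c, l.count c = l.length := by
  classical
  induction l with
  | nil => simp
  | cons a l ih => simp [List.count_cons, Finset.sum_add_distrib, ih]

theorem perm_dirsOf {k : ℕ} (l : List (Fin T × Fin din)) (hl : l.length ≤ k) :
    ∃ n : Fin T × Fin din → Fin (k + 1), ∑ c, (n c : ℕ) = l.length ∧
      (l.map coordVec).Perm (dirsOf n) := by
  have hc : ∀ c, l.count c ≤ k := fun c => List.count_le_length.trans hl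
  refine ⟨fun c => ⟨l.count c, Nat.lt_succ_of_le (hc c)⟩, ?_, ?_⟩
  · exact sum_count_eq_length l
  · let L : List (Fin T × Fin din) :=
      (Finset.univ.toList (α := Fin T × Fin din)).flatMap fun c => List.replicate (l.count c) c
    have hL : l.Perm L := by
      rw [List.perm_iff_count]
      intro a
      simp only [L, List.count_flatMap, Finset.sum_map_toList]
      rw [Finset.sum_eq_single a]
      · simp
      · intro b _ hb
        simp [List.count_replicate, hb]
      · simp
    have key : ∀ M : List (Fin T × Fin din),
        (M.flatMap fun c => List.replicate (l.count c) c).map coordVec =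
        M.foldr (fun c acc => List.replicate (l.count c) (coordVec c) ++ acc) [] := by
      intro M
      induction M with
      | nil => rfl
      | cons c M ih => simp [← ih]
    have := hL.map coordVec
    rwa [key] at this

theorem continuousOn_of_abs_sub_le_rpow {E : Type*} [SeminormedAddCommGroup E] {s : Set E}
    {g : E → ℝ} {C ω : ℝ} (hω : 0 < ω) (h : ∀ x ∈ s, ∀ y ∈ s, |g x - g y| ≤ C * ‖x - y‖ ^ ω) :
    ContinuousOn g s := by
  intro x hx
  have : Filter.Tendsto (fun y => C * ‖y - x‖ ^ ω) (nhdsWithin x s) (nhds 0) := by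
    have hc : ContinuousAt (fun y : E => C * ‖y - x‖ ^ ω) x := by
      refine continuousAt_const.mul (ContinuousAt.rpow_const (by fun_prop) (Or.inr hω.le))
    have := hc.tendsto
    simp only [sub_self, norm_zero, Real.zero_rpow hω.ne', mul_zero] at this
    exact this.mono_left nhdsWithin_le_nhds
  rw [ContinuousWithinAt, tendsto_iff_norm_sub_tendsto_zero]
  refine squeeze_zero' (Filter.Eventually.of_forall fun _ => norm_nonneg _) ?_ this
  filter_upwards [self_mem_nhdsWithin] with y hy
  exact h y hy x hx

theorem MemHolderClass.bounds {β U : ℝ} {f : (Fin T → Fin din → ℝ) → Fin dout → ℝ}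
    (hf : MemHolderClass T din dout β U f) :
    ∃ (k : ℕ) (ω : ℝ), β = k + ω ∧ 0 < ω ∧ ω ≤ 1 ∧ ∀ i,
      (∀ l : List (Fin T × Fin din), l.length < k →
        DifferentiableOn ℝ (dirDerivList (cube T din) (l.map coordVec) fun y => f y i)
          (cube T din)) ∧
      (∀ l : List (Fin T × Fin din), l.length ≤ k → ∀ x ∈ cube T din,
        |dirDerivList (cube T din) (l.map coordVec) (fun y => f y i) x| ≤ U) ∧
      (∀ l : List (Fin T × Fin din), l.length = k → ∀ x ∈ cube T din, ∀ y ∈ cube T din,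
        |dirDerivList (cube T din) (l.map coordVec) (fun y => f y i) x -
          dirDerivList (cube T din) (l.map coordVec) (fun y => f y i) y| ≤
            U * ‖x - y‖ ^ ω) := by
  obtain ⟨k, ω, hβ, ⟨hω₀, hω₁⟩, h₁, h₂, h₃, h₄⟩ := hf
  refine ⟨k, ω, hβ, hω₀, hω₁, fun i => ?_⟩
  have hd : ∀ l : List (Fin T × Fin din), l.length < k →
      DifferentiableOn ℝ (dirDerivList (cube T din) (l.map coordVec) fun y => f y i)
        (cube T din) := fun l hl x hx => h₁ i l hl x hx
  have hcont : ∀ l : List (Fin T × Fin din), l.length = k →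
      ContinuousOn (dirDerivList (cube T din) (l.map coordVec) fun y => f y i)
        (cube T din) := by
    intro l hl
    obtain ⟨C, hC⟩ := h₃ i l hl
    exact continuousOn_of_abs_sub_le_rpow hω₀ hC
  have hF : ContDiffOn ℝ k (fun y => f y i) (cube T din) :=
    contDiffOn_of_dirDerivList uniqueDiffOn_cube (e := coordVec)
      (fun y => ⟨_, eq_sum_coordVec y⟩) hd hcont
  have hA : ∀ n : Fin T × Fin din → Fin (k + 1), 0 ≤ (if (∑ c, ((n c : ℕ))) ≤ k then
          sSup ((fun x =>
            |dirDerivList (cube T din) (dirsOf n) (fun y => f y i) x|) '' cube T din)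
        else 0) := by
    intro n
    split_ifs
    · refine Real.sSup_nonneg ?_
      rintro _ ⟨x, -, rfl⟩
      exact abs_nonneg _
    · exact le_rfl
  have hB : ∀ n : Fin T × Fin din → Fin (k + 1), 0 ≤ (if (∑ c, ((n c : ℕ))) = k then
          sSup {r : ℝ | ∃ x ∈ cube T din, ∃ y ∈ cube T din, x ≠ y ∧
            r = |dirDerivList (cube T din) (dirsOf n) (fun z => f z i) x
                  - dirDerivList (cube T din) (dirsOf n) (fun z => f z i) y|
                / ‖x - y‖ ^ ω}
        else 0) := by
    intro n
    split_ifs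
    · refine Real.sSup_nonneg ?_
      rintro _ ⟨x, -, y, -, -, rfl⟩
      positivity
    · exact le_rfl
  refine ⟨hd, fun l hl x hx => ?_, fun l hl x hx y hy => ?_⟩
  · obtain ⟨n, hn, hp⟩ := perm_dirsOf l hl
    have e := dirDerivList_perm uniqueDiffOn_cube cube_subset_closure_interior hF hp
      (by simpa using hl)
    obtain ⟨C, hC⟩ := h₂ i l hl
    have hle := (Finset.single_le_sum (fun n _ => hA n) (Finset.mem_univ n)).trans
      (le_add_of_nonneg_right (Finset.sum_nonneg fun n _ => hB n)) |>.trans (h₄ i)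
    rw [if_pos (hn.trans_le hl)] at hle
    rw [e x hx]
    refine (le_csSup ?_ (Set.mem_image_of_mem _ hx)).trans hle
    refine ⟨C, ?_⟩
    rintro _ ⟨z, hz, rfl⟩
    beta_reduce
    rw [← e z hz]
    exact hC z hz
  · obtain ⟨n, hn, hp⟩ := perm_dirsOf l hl.le
    have e := dirDerivList_perm uniqueDiffOn_cube cube_subset_closure_interior hF hp
      (by simpa using hl.le)
    obtain ⟨C, hC⟩ := h₃ i l hl
    have hle := (Finset.single_le_sum (fun n _ => hB n) (Finset.mem_univ n)).trans
      (le_add_of_nonneg_left (Finset.sum_nonneg fun n _ => hA n)) |>.trans (h₄ i)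
    rw [if_pos (hn.trans hl)] at hle
    rcases eq_or_ne x y with rfl | hxy
    · simp [Real.zero_rpow hω₀.ne']
    · have hpos : 0 < ‖x - y‖ ^ ω := Real.rpow_pos_of_pos (norm_pos_iff.2 (sub_ne_zero.2 hxy)) _
      rw [← div_le_iff₀ hpos]
      rw [e x hx, e y hy]
      refine le_trans (le_csSup ?_ ?_) hle
      · refine ⟨C, ?_⟩
        rintro _ ⟨z, hz, w, hw, hzw, rfl⟩
        rw [← e z hz, ← e w hw, div_le_iff₀
          (Real.rpow_pos_of_pos (norm_pos_iff.2 (sub_ne_zero.2 hzw)) _)]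
        exact hC z hz w hw
      · exact ⟨x, hx, y, hy, hxy, rfl⟩

end HolderClass

section LocalApproximation

variable {Ω : Type*} {W m T din : ℕ} {S : Set (Ω → ℝ)}

theorem card_multiindex_le (κ : Type*) [Fintype κ] (hκ : 0 < Fintype.card κ) (k : ℕ) :
    Fintype.card (Σ j : Fin (k + 1), Fin j → κ) ≤ (k + 1) * Fintype.card κ ^ k := by
  rw [Fintype.card_sigma]
  refine (Finset.sum_le_card_nsmul _ _ (Fintype.card κ ^ k) fun j _ => ?_).trans (by simp)
  rw [Fintype.card_fun, Fintype.card_fin]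
  exact Nat.pow_le_pow_right hκ (Nat.lt_succ_iff.1 j.2)

/-- Approximation of a Hölder function away from the faces of a grid. -/
theorem Reach.holder_of_digits {F : (Fin T → Fin din → ℝ) → ℝ} {k : ℕ} {ω β U : ℝ} (hU : 0 < U)
    (hβ : β = k + ω) (hω : 0 < ω)
    (hd : ∀ l : List (Fin T × Fin din), l.length < k →
      DifferentiableOn ℝ (dirDerivList (cube T din) (l.map coordVec) F) (cube T din))
    (hb : ∀ l : List (Fin T × Fin din), l.length ≤ k → ∀ x ∈ cube T din,
      |dirDerivList (cube T din) (l.map coordVec) F x| ≤ U)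
    (hh : ∀ l : List (Fin T × Fin din), l.length = k → ∀ x ∈ cube T din, ∀ y ∈ cube T din,
      |dirDerivList (cube T din) (l.map coordVec) F x -
        dirDerivList (cube T din) (l.map coordVec) F y| ≤ U * ‖x - y‖ ^ ω)
    {ξ : Fin T × Fin din → Ω → ℝ} (hξ : ∀ c, ξ c ∈ affSpan S)
    (hξ1 : ∀ w c, ξ c w ≤ 1) {a b : Ω → Fin T × Fin din → ℕ}
    {M N L : ℕ} (hN : 0 < N) (hL : 0 < L) (hM0 : 0 < M)
    (haM : ∀ w c, a w c < M) (hbM : ∀ w c, b w c < M)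
    (hM : M ^ Fintype.card (Fin T × Fin din) ≤ N * m) (hM' : M ≤ N * m) {δ : ℝ} (hδ : 0 < δ)
    (h₁ : ∀ w c, (a w c * M + b w c : ℝ) ≤ M ^ 2 * ξ c w)
    (h₂ : ∀ w c, a w c * M + b w c + 1 < M ^ 2 → M ^ 2 * ξ c w ≤ a w c * M + b w c + 1 - δ)
    (h₃ : ∀ w c, M ^ 2 * ξ c w ≤ a w c * M + b w c + 1) (t P s : ℕ) {E : ℝ}
    (hE₁ : (1 / ((N * L : ℕ) : ℝ) ^ 2) ^ t ≤ E) (hE₂ : (1 / 2) ^ (P * s) ≤ E)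
    (hW₁ : Fintype.card (Fin T × Fin din) * (2 * N + 10) ≤ W)
    (hW₂ : Fintype.card (Σ j : Fin (k + 1), Fin j → Fin T × Fin din) *
      (max (P * (4 * N + 17)) (3 * N + 28) + 2 * Fintype.card (Fin T × Fin din)) ≤ W) :
    ∃ O : Ω → ℝ, (∀ w, |O w - F fun t i => ξ (t, i) w| ≤
        Fintype.card (Σ j : Fin (k + 1), Fin j → Fin T × Fin din) * (U * (3 * (k + 1) * E)) +
        U * (Fintype.card (Fin T × Fin din) ^ k / k.factorial * (1 / (M : ℝ) ^ 2) ^ β)) ∧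
      Reach W (m + m + (s * (3 * m + 2) + (k + 1) * (t * L + 1))) S {O} := by
  classical
  have hMr : (0 : ℝ) < M := by exact_mod_cast hM0
  have hM1 : (1 : ℝ) ≤ M := by exact_mod_cast hM0
  let pt : (Fin T × Fin din → ℕ) → (Fin T × Fin din → ℕ) → Fin T → Fin din → ℝ :=
    fun a b t i => (a (t, i) * M + b (t, i)) / M ^ 2
  let g : (Σ j : Fin (k + 1), Fin j → Fin T × Fin din) →
      (Fin T × Fin din → ℕ) → (Fin T × Fin din → ℕ) → ℝ := fun l a b =>
    if pt a b ∈ cube T din then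
      (dirDerivList (cube T din) ((List.ofFn l.2).map coordVec) F (pt a b) /
        ((l.1 : ℕ).factorial * U) + 1) / 2 else 0
  have hg : ∀ l a b, g l a b ∈ Set.Icc (0 : ℝ) 1 := by
    intro l a b
    simp only [g]
    split_ifs with h
    · have hf : (1 : ℝ) ≤ (l.1 : ℕ).factorial := by exact_mod_cast Nat.factorial_pos _
      have h' := hb (List.ofFn l.2) (by simpa using Nat.lt_succ_iff.1 l.1.2) _ h
      have : |dirDerivList (cube T din) ((List.ofFn l.2).map coordVec) F (pt a b) /
        ((l.1 : ℕ).factorial * U)| ≤ 1 := by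
        rw [abs_div, abs_of_pos (by positivity : 0 < ((l.1 : ℕ).factorial : ℝ) * U),
          div_le_one (by positivity)]
        nlinarith
      rw [abs_le] at this
      constructor <;> linarith [this.1, this.2]
    · simp
  obtain ⟨O, hO, rO⟩ := Reach.piecewise_poly (k := k) hξ hN hL haM hbM hM hM' hδ h₁ h₂ h₃ hg t P s
    hE₁ hE₂ (fun l => List.ofFn l.2) (fun l => by simpa using Nat.lt_succ_iff.1 l.1.2)
    (fun l => U * (1 / (M : ℝ) ^ 2) ^ (l.1 : ℕ)) (U := U) (fun l => by
      rw [abs_of_nonneg (by positivity)]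
      refine mul_le_of_le_one_right hU.le (pow_le_one₀ (by positivity) ?_)
      rw [div_le_one (by positivity)]
      exact one_le_pow₀ hM1) hW₁ hW₂
  refine ⟨O, fun w => ?_, rO⟩
  refine (abs_sub_le _ _ _).trans (add_le_add (hO w) ?_)
  rw [abs_sub_comm]
  set x := pt (a w) (b w) with hx
  have hX : (fun t i => ξ (t, i) w) ∈ cube T din := by
    intro t i
    refine ⟨?_, hξ1 w (t, i)⟩
    have := h₁ w (t, i)
    have h0 : (0 : ℝ) ≤ M ^ 2 * ξ (t, i) w := le_trans (by positivity) this
    exact nonneg_of_mul_nonneg_right h0 (by positivity)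
  have hle : ∀ c : Fin T × Fin din, x c.1 c.2 ≤ ξ c w := by
    intro c
    simp only [hx, pt]
    rw [div_le_iff₀ (by positivity), mul_comm (ξ c w)]
    exact h₁ w c
  have hge : ∀ c : Fin T × Fin din, ξ c w ≤ x c.1 c.2 + 1 / M ^ 2 := by
    intro c
    simp only [hx, pt]
    rw [← add_div, le_div_iff₀ (by positivity), mul_comm (ξ c w)]
    exact h₃ w c
  have hxc : x ∈ cube T din := by
    intro t i
    refine ⟨?_, (hle (t, i)).trans (hX t i).2⟩
    simp only [hx, pt]
    positivity
  let α : Fin T × Fin din → ℝ := fun c => ξ c w - x c.1 c.2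
  have hsum : x + ∑ c, α c • coordVec c = fun t i => ξ (t, i) w := by
    have := eq_sum_coordVec ((fun t i => ξ (t, i) w) - x)
    change x + ∑ c : Fin T × Fin din, ((fun t i => ξ (t, i) w) - x) c.1 c.2 • coordVec c = _
    rw [← this, add_sub_cancel]
  have hα : ∀ c, |α c| ≤ 1 / (M : ℝ) ^ 2 := by
    intro c
    rw [abs_of_nonneg (sub_nonneg.2 (hle c))]
    exact sub_le_iff_le_add'.2 (hge c)
  have hnorm : ‖∑ c, α c • coordVec c‖ ≤ 1 / (M : ℝ) ^ 2 := by
    have e : (∑ c, α c • coordVec c) = fun t i => α (t, i) := by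
      rw [← sub_eq_of_eq_add' hsum.symm]
      rfl
    rw [e]
    refine (pi_norm_le_iff_of_nonneg (by positivity)).2 fun t =>
      (pi_norm_le_iff_of_nonneg (by positivity)).2 fun i => ?_
    exact hα (t, i)
  have htaylor := abs_sub_taylor_dirDerivList_le convex_cube (e := coordVec) (a := α) hd hxc
    (by rw [hsum]; exact hX) hα (M := U * (1 / (M : ℝ) ^ 2) ^ ω) (by
      intro l hl t ht
      have hmem : x + t • ∑ c, α c • coordVec c ∈ cube T din := by
        have := convex_cube.add_smul_sub_mem hxc hX ht
        rwa [← hsum, add_sub_cancel_left] at this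
      refine (hh l hl _ hmem x hxc).trans ?_
      rw [add_sub_cancel_left, norm_smul, Real.norm_of_nonneg ht.1]
      refine mul_le_mul_of_nonneg_left (Real.rpow_le_rpow (by have := ht.1; positivity) ?_ hω.le)
        hU.le
      exact (mul_le_of_le_one_left (norm_nonneg _) ht.2).trans hnorm)
  rw [hsum] at htaylor
  have hmain : (∑ l : Σ j : Fin (k + 1), Fin j → Fin T × Fin din,
      U * (1 / (M : ℝ) ^ 2) ^ (l.1 : ℕ) * ((2 * g l (a w) (b w) - 1) *
        ((List.ofFn l.2).map fun c =>
          (M : ℝ) ^ 2 * ξ c w - (a w c * M + b w c)).prod)) =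
      ∑ j ∈ Finset.range (k + 1), ∑ l : Fin j → Fin T × Fin din, (1 / j.factorial : ℝ) *
        (dirDerivList (cube T din) ((List.ofFn l).map coordVec) F x *
          ((List.ofFn l).map α).prod) := by
    rw [Finset.sum_range, Fintype.sum_sigma]
    refine Finset.sum_congr rfl fun j _ => Finset.sum_congr rfl fun l _ => ?_
    have hg' : 2 * g ⟨j, l⟩ (a w) (b w) - 1 =
        dirDerivList (cube T din) ((List.ofFn l).map coordVec) F x /
          ((j : ℕ).factorial * U) := by
      simp only [g]
      rw [if_pos hxc]
      ring
    have hprod : ∀ l : List (Fin T × Fin din), (1 / (M : ℝ) ^ 2) ^ l.length *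
        (l.map fun c => (M : ℝ) ^ 2 * ξ c w - (a w c * M + b w c)).prod = (l.map α).prod := by
      intro l
      induction l with
      | nil => simp
      | cons c l ih =>
        rw [List.map_cons, List.prod_cons, List.map_cons, List.prod_cons, List.length_cons, ← ih]
        have : α c = 1 / (M : ℝ) ^ 2 * ((M : ℝ) ^ 2 * ξ c w - (a w c * M + b w c)) := by
          simp only [α, hx, pt]
          field_simp
        rw [this]
        ring
    have h := hprod (List.ofFn l)
    rw [List.length_ofFn] at h
    rw [hg', ← h]
    have hf : ((j : ℕ).factorial : ℝ) ≠ 0 := by positivity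
    field_simp
  rw [hmain]
  refine htaylor.trans_eq ?_
  rw [hβ, Real.rpow_add (by positivity), Real.rpow_natCast]
  ring

end LocalApproximation

section ShiftedGrids

/-- `z` does not lie in the last `δ / K` of a cell of the grid of step `1 / K`. -/
def AwayFromGrid (K : ℕ) (δ z : ℝ) : Prop :=
  ⌊K * z⌋₊ + 1 < K → K * z ≤ ⌊K * z⌋₊ + 1 - δ

/-- The coordinate `x`, shifted by `r` and clipped to `[0, 1]`. -/
def clipShift (r x : ℝ) : ℝ := relu (x + r) - relu (x + r - 1)

theorem clipShift_eq {r x : ℝ} (h₀ : 0 < clipShift r x) (h₁ : clipShift r x < 1) :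
    clipShift r x = x + r := by
  unfold clipShift at *
  rcases le_total (x + r) 0 with h | h
  · rw [relu_of_nonpos h, relu_of_nonpos (by linarith)] at h₀
    simp at h₀
  · rcases le_total (x + r - 1) 0 with h' | h'
    · rw [relu_of_nonneg h, relu_of_nonpos h', sub_zero]
    · rw [relu_of_nonneg h, relu_of_nonneg h'] at h₁
      linarith

/-- The three shifts by multiples of `δ / K`. -/
noncomputable def gridShift (K : ℕ) (δ : ℝ) (s : Fin 3) : ℝ := δ * ((s : ℕ) - 1) / K

theorem exists_of_not_awayFromGrid {K : ℕ} {δ : ℝ} (hδ' : δ ≤ 1 / 3)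
    {s : Fin 3} {x : ℝ} (h : ¬AwayFromGrid K δ (clipShift (gridShift K δ s) x)) :
    ∃ n : ℕ, n - δ < K * x + δ * ((s : ℕ) - 1) ∧ K * x + δ * ((s : ℕ) - 1) < n := by
  unfold AwayFromGrid at h
  push Not at h
  obtain ⟨h₁, h₂⟩ := h
  set z := clipShift (gridShift K δ s) x with hz
  have hK : (0 : ℝ) < K := by
    have : 0 < K := by omega
    exact_mod_cast this
  have h₃ := Nat.lt_floor_add_one (K * z)
  have h₄ : (⌊K * z⌋₊ : ℝ) + 1 < K := by exact_mod_cast h₁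
  have h₅ : (0 : ℝ) ≤ ⌊K * z⌋₊ := Nat.cast_nonneg _
  have hz₀ : 0 < z := by
    refine pos_of_mul_pos_right (lt_trans ?_ h₂) hK.le
    linarith
  have hz₁ : z < 1 := by
    refine lt_of_mul_lt_mul_left (lt_trans h₃ ?_) hK.le
    linarith
  have he := clipShift_eq hz₀ hz₁
  have hKz : K * z = K * x + δ * ((s : ℕ) - 1) := by
    rw [hz, he, gridShift]
    field_simp
  refine ⟨⌊K * z⌋₊ + 1, ?_, ?_⟩
  · rw [← hKz]; push_cast; exact h₂
  · rw [← hKz]; push_cast; exact h₃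

theorem awayFromGrid_or {K : ℕ} {δ : ℝ} (hδ : 0 < δ) (hδ' : δ ≤ 1 / 3) (x : ℝ) {s s' : Fin 3}
    (hs : s < s') : AwayFromGrid K δ (clipShift (gridShift K δ s) x) ∨
      AwayFromGrid K δ (clipShift (gridShift K δ s') x) := by
  by_contra! h
  obtain ⟨n, h₁, h₂⟩ := exists_of_not_awayFromGrid hδ' h.1
  obtain ⟨n', h₃, h₄⟩ := exists_of_not_awayFromGrid hδ' h.2
  have e₁ : ((s : ℕ) : ℝ) + 1 ≤ (s' : ℕ) := by exact_mod_cast hs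
  have e₂ : ((s' : ℕ) : ℝ) ≤ 2 := by exact_mod_cast Nat.lt_succ_iff.1 s'.2
  have e₀ : (0 : ℝ) ≤ ((s : ℕ) : ℝ) := Nat.cast_nonneg _
  have e₃ : δ * ((s : ℕ) + 1) ≤ δ * (s' : ℕ) := mul_le_mul_of_nonneg_left e₁ hδ.le
  have e₄ : δ * (s' : ℕ) ≤ δ * 2 := mul_le_mul_of_nonneg_left e₂ hδ.le
  have e₅ : 0 ≤ δ * ((s : ℕ) : ℝ) := by positivity
  rcases lt_trichotomy n n' with h' | h' | h'
  · have : (n : ℝ) + 1 ≤ n' := by exact_mod_cast h'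
    nlinarith
  · subst h'
    nlinarith
  · have : (n' : ℝ) + 1 ≤ n := by exact_mod_cast h'
    nlinarith

theorem abs_clipShift_sub_le {K : ℕ} {δ : ℝ} (hδ : 0 < δ) (hK : 0 < K) (s : Fin 3) {x : ℝ}
    (hx : x ∈ Set.Icc (0 : ℝ) 1) : |clipShift (gridShift K δ s) x - x| ≤ δ := by
  refine (abs_relu_sub_relu_sub_one_sub_le _ hx).trans ?_
  have hK' : (1 : ℝ) ≤ K := by exact_mod_cast hK
  have hs : |((s : ℕ) : ℝ) - 1| ≤ 1 := by
    have e₂ : ((s : ℕ) : ℝ) ≤ 2 := by exact_mod_cast Nat.lt_succ_iff.1 s.2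
    have e₀ : (0 : ℝ) ≤ ((s : ℕ) : ℝ) := Nat.cast_nonneg _
    rw [abs_le]
    constructor <;> linarith
  rw [add_sub_cancel_left, gridShift, abs_div, abs_mul, abs_of_pos hδ, Nat.abs_cast]
  refine (div_le_self (by positivity) hK').trans ?_
  nlinarith

variable {W m T din dout : ℕ}

/-- The coordinate functions on the unit cube. -/
def cubeCoords (T din : ℕ) : Set (cube T din → ℝ) :=
  Set.range fun (c : Fin T × Fin din) x => x.1 c.1 c.2

/-- Local approximations of a Hölder function on all shifted grids. -/
theorem Reach.holder_shifts {f : (Fin T → Fin din → ℝ) → Fin dout → ℝ} {k : ℕ} {ω β U : ℝ}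
    (hU : 0 < U) (hβ : β = k + ω) (hω : 0 < ω)
    (hf : ∀ i, (∀ l : List (Fin T × Fin din), l.length < k →
        DifferentiableOn ℝ (dirDerivList (cube T din) (l.map coordVec) fun y => f y i)
          (cube T din)) ∧
      (∀ l : List (Fin T × Fin din), l.length ≤ k → ∀ x ∈ cube T din,
        |dirDerivList (cube T din) (l.map coordVec) (fun y => f y i) x| ≤ U) ∧
      (∀ l : List (Fin T × Fin din), l.length = k → ∀ x ∈ cube T din, ∀ y ∈ cube T din,
        |dirDerivList (cube T din) (l.map coordVec) (fun y => f y i) x -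
          dirDerivList (cube T din) (l.map coordVec) (fun y => f y i) y| ≤
            U * ‖x - y‖ ^ ω))
    {M N L : ℕ} (hN : 0 < N) (hL : 0 < L) (hM0 : 0 < M)
    (hM : M ^ Fintype.card (Fin T × Fin din) ≤ N * m) (hM' : M ≤ N * m)
    {δ η : ℝ} (hδ : 0 < δ)
    (hη : ∀ i, ∀ x ∈ cube T din, ∀ y ∈ cube T din, ‖x - y‖ ≤ δ → |f x i - f y i| ≤ η)
    (t P s : ℕ) {E : ℝ}
    (hE₁ : (1 / ((N * L : ℕ) : ℝ) ^ 2) ^ t ≤ E) (hE₂ : (1 / 2) ^ (P * s) ≤ E)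
    (hW₁ : Fintype.card (Fin T × Fin din) * (2 * N + 10) ≤ W)
    (hW₂ : Fintype.card (Σ j : Fin (k + 1), Fin j → Fin T × Fin din) *
      (max (P * (4 * N + 17)) (3 * N + 28) + 2 * Fintype.card (Fin T × Fin din)) ≤ W)
    {W' : ℕ} (hW' : 6 * Fintype.card (Fin T × Fin din) ≤ W')
    (hW'' : Fintype.card ((Fin T × Fin din → Fin 3) × Fin dout) * W ≤ W') :
    ∃ v : (Fin T × Fin din → Fin 3) × Fin dout → cube T din → ℝ,
      (∀ s i (x : cube T din),
        (∀ c, AwayFromGrid (M ^ 2) δ (clipShift (gridShift (M ^ 2) δ (s c)) (x.1 c.1 c.2))) →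
        |v (s, i) x - f x.1 i| ≤
        Fintype.card (Σ j : Fin (k + 1), Fin j → Fin T × Fin din) * (U * (3 * (k + 1) * E)) +
        U * (Fintype.card (Fin T × Fin din) ^ k / k.factorial * (1 / (M : ℝ) ^ 2) ^ β) + η) ∧
      Reach W' (1 + (m + m + (s * (3 * m + 2) + (k + 1) * (t * L + 1)))) (cubeCoords T din)
        (Set.range v) := by
  classical
  let g : (Fin T × Fin din) × Fin 3 × Bool → cube T din → ℝ := fun q x =>
    x.1 q.1.1 q.1.2 + gridShift (M ^ 2) δ q.2.1 - (if q.2.2 then 1 else 0)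
  have hg : ∀ q, g q ∈ affSpan (cubeCoords T din) := fun q =>
    sub_mem_affSpan (add_mem_affSpan (subset_affSpan _ ⟨q.1, rfl⟩) (const_mem_affSpan _ _))
      (const_mem_affSpan _ _)
  have r₁ := Reach.layer (W := W') (by
    simp only [Fintype.card_prod, Fintype.card_fin, Fintype.card_bool] at hW' ⊢
    omega) g hg
  set S₁ := Set.range fun q x => relu (g q x) with hS₁
  have hclip : ∀ (c : Fin T × Fin din) (s : Fin 3),
      (fun x : cube T din => clipShift (gridShift (M ^ 2) δ s) (x.1 c.1 c.2)) ∈ affSpan S₁ := by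
    intro c s
    refine mem_affSpan_congr (sub_mem_affSpan (subset_affSpan _ ⟨(c, s, false), rfl⟩)
      (subset_affSpan _ ⟨(c, s, true), rfl⟩)) fun x => ?_
    simp [g, clipShift]
  have hM2 : 0 < M ^ 2 := by positivity
  have key : ∀ p : (Fin T × Fin din → Fin 3) × Fin dout, ∃ v : cube T din → ℝ,
      (∀ x : cube T din,
        (∀ c, AwayFromGrid (M ^ 2) δ (clipShift (gridShift (M ^ 2) δ (p.1 c)) (x.1 c.1 c.2))) →
        |v x - f x.1 p.2| ≤
        Fintype.card (Σ j : Fin (k + 1), Fin j → Fin T × Fin din) * (U * (3 * (k + 1) * E)) +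
        U * (Fintype.card (Fin T × Fin din) ^ k / k.factorial * (1 / (M : ℝ) ^ 2) ^ β) + η) ∧
      Reach W (m + m + (s * (3 * m + 2) + (k + 1) * (t * L + 1))) S₁ {v} := by
    rintro ⟨r, i⟩
    let Ω₀ := {x : cube T din // ∀ c, AwayFromGrid (M ^ 2) δ
      (clipShift (gridShift (M ^ 2) δ (r c)) (x.1 c.1 c.2))}
    let ρ : Ω₀ → cube T din := Subtype.val
    let ξ : Fin T × Fin din → Ω₀ → ℝ := fun c w =>
      clipShift (gridShift (M ^ 2) δ (r c)) (w.1.1 c.1 c.2)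
    have hmem : ∀ c w, ξ c w ∈ Set.Icc (0 : ℝ) 1 := fun c w => relu_sub_relu_sub_one_mem _
    have hξ : ∀ c, ξ c ∈ affSpan ((fun f => f ∘ ρ) '' S₁) := by
      intro c
      have h : affSpan S₁ ≤
          (affSpan ((fun f => f ∘ ρ) '' S₁)).comap (LinearMap.funLeft ℝ ℝ ρ) := by
        refine Submodule.span_le.2 (Set.insert_subset (const_mem_affSpan _ 1) ?_)
        exact fun f hf => subset_affSpan _ ⟨f, hf, rfl⟩
      exact h (hclip c (r c))
    let q : Ω₀ → Fin T × Fin din → ℕ := fun w c =>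
      min ⌊((M ^ 2 : ℕ) : ℝ) * ξ c w⌋₊ (M ^ 2 - 1)
    have hq : ∀ w c, ((q w c / M : ℕ) : ℝ) * M + (q w c % M : ℕ) = q w c := by
      intro w c
      exact_mod_cast Nat.div_add_mod' (q w c) M
    have hqn : ∀ w c, q w c / M * M + q w c % M = q w c := fun w c => Nat.div_add_mod' _ _
    have hqM : ∀ w c, q w c < M ^ 2 := fun w c => (min_le_right _ _).trans_lt (by omega)
    have hcast : ((M ^ 2 : ℕ) : ℝ) = (M : ℝ) ^ 2 := by push_cast; rfl
    have hpos : ∀ w c, 0 ≤ ((M ^ 2 : ℕ) : ℝ) * ξ c w := fun w c =>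
      mul_nonneg (Nat.cast_nonneg _) (hmem c w).1
    obtain ⟨O, hO, rO⟩ := Reach.holder_of_digits (F := fun y => f y i) hU hβ hω (hf i).1
      (hf i).2.1 (hf i).2.2 hξ (fun w c => (hmem c w).2)
      (a := fun w c => q w c / M) (b := fun w c => q w c % M) hN hL hM0
      (fun w c => Nat.div_lt_of_lt_mul (by rw [← sq]; exact hqM w c))
      (fun w c => Nat.mod_lt _ hM0) hM hM' hδ
      (fun w c => by
        rw [hq, ← hcast]
        exact (Nat.cast_le.2 (min_le_left _ _)).trans (Nat.floor_le (hpos w c)))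
      (fun w c h => by
        rw [hqn] at h
        rw [hq, ← hcast]
        have hfl : q w c = ⌊((M ^ 2 : ℕ) : ℝ) * ξ c w⌋₊ := by
          simp only [q] at h ⊢
          omega
        rw [hfl] at h ⊢
        exact w.2 c h)
      (fun w c => by
        rw [hq, ← hcast]
        simp only [q]
        rcases le_total ⌊((M ^ 2 : ℕ) : ℝ) * ξ c w⌋₊ (M ^ 2 - 1) with h | h
        · rw [min_eq_left h]
          exact (Nat.lt_floor_add_one _).le
        · rw [min_eq_right h, Nat.cast_sub hM2, Nat.cast_one, sub_add_cancel]
          exact mul_le_of_le_one_right (Nat.cast_nonneg _) (hmem c w).2)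
      t P s hE₁ hE₂ hW₁ hW₂
    obtain ⟨S', rS', hS'⟩ := Reach.lift ρ rO
    obtain ⟨v, hv, hvO⟩ := hS' rfl
    refine ⟨v, fun x hx => ?_, rS'.right (Set.singleton_subset_iff.2 (subset_affSpan _ hv))⟩
    have hvx : v x = O ⟨x, hx⟩ := congrFun hvO ⟨x, hx⟩
    rw [hvx]
    refine (abs_sub_le _ _ _).trans (add_le_add (hO ⟨x, hx⟩) ?_)
    refine hη i _ (fun t i => hmem (t, i) ⟨x, hx⟩) _ x.2 ?_
    refine (pi_norm_le_iff_of_nonneg hδ.le).2 fun t =>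
      (pi_norm_le_iff_of_nonneg hδ.le).2 fun i => ?_
    exact abs_clipShift_sub_le hδ hM2 _ (x.2 t i)
  choose v hv rv using key
  refine ⟨v, fun s i x hx => hv (s, i) x hx, r₁.trans (((Reach.iUnion rv).width hW'').right ?_)⟩
  rintro _ ⟨p, rfl⟩
  exact subset_affSpan _ (Set.mem_iUnion.2 ⟨p, rfl⟩)

end ShiftedGrids

section Medians

/-- The median of three numbers. -/
def median₃ (a b c : ℝ) : ℝ := max (min a b) (min (max a b) c)

theorem abs_median₃_sub_le {v : Fin 3 → ℝ} {y ε : ℝ}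
    (h : ∀ i j, i < j → |v i - y| ≤ ε ∨ |v j - y| ≤ ε) :
    |median₃ (v 0) (v 1) (v 2) - y| ≤ ε := by
  have h₁ := h 0 1 (by decide)
  have h₂ := h 0 2 (by decide)
  have h₃ := h 1 2 (by decide)
  simp only [abs_le] at *
  unfold median₃
  rcases le_total (v 0) (v 1) with h | h <;> rcases le_total (v 0) (v 2) with h' | h' <;>
    rcases le_total (v 1) (v 2) with h'' | h'' <;>
    simp only [max_eq_left, max_eq_right, min_eq_left, min_eq_right, h, h', h''] <;>
    constructor <;> rcases h₁ with h₁ | h₁ <;> rcases h₂ with h₂ | h₂ <;>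
    rcases h₃ with h₃ | h₃ <;> linarith [h₁.1, h₁.2, h₂.1, h₂.2, h₃.1, h₃.2]

variable {Ω : Type*} {S : Set (Ω → ℝ)}

theorem max_eq_add_relu (a b : ℝ) : max a b = b + relu (a - b) := by
  unfold relu
  rw [← max_add_add_left, add_sub_cancel, add_zero]

theorem min_eq_sub_relu (a b : ℝ) : min a b = a - relu (a - b) := by
  have := min_add_max a b
  rw [max_eq_add_relu] at this
  linarith

theorem Reach.median {a b c : Ω → ℝ} (ha : a ∈ affSpan S) (hb : b ∈ affSpan S)
    (hc : c ∈ affSpan S) : Reach 7 3 S {fun w => median₃ (a w) (b w) (c w)} := by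
  have r₁ := ((Reach.carry_one 1 ha).union (Reach.carry_one 1 hb)).union
    ((Reach.carry_one 1 hc).union (Reach.layer (κ := Unit) (W := 1) (by simp)
      (fun _ w => a w - b w) (fun _ => sub_mem_affSpan ha hb)))
  set S₁ := ({a} ∪ {b} : Set (Ω → ℝ)) ∪ ({c} ∪ Set.range fun (_ : Unit) w => relu (a w - b w))
  have ha₁ : a ∈ affSpan S₁ := subset_affSpan _ (by simp [S₁])
  have hb₁ : b ∈ affSpan S₁ := subset_affSpan _ (by simp [S₁])
  have hc₁ : c ∈ affSpan S₁ := subset_affSpan _ (by simp [S₁])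
  have hd₁ : (fun w => relu (a w - b w)) ∈ affSpan S₁ := subset_affSpan _ (by simp [S₁])
  have hp₁ : (fun w => min (a w) (b w)) ∈ affSpan S₁ :=
    mem_affSpan_congr (sub_mem_affSpan ha₁ hd₁) fun w => min_eq_sub_relu _ _
  have hq₁ : (fun w => max (a w) (b w)) ∈ affSpan S₁ :=
    mem_affSpan_congr (add_mem_affSpan hb₁ hd₁) fun w => max_eq_add_relu _ _
  have r₂ := (Reach.carry_one 1 hp₁).union ((Reach.carry_one 1 hq₁).union
    (Reach.layer (κ := Unit) (W := 3) (by simp)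
      (fun _ w => max (a w) (b w) - c w) (fun _ => sub_mem_affSpan hq₁ hc₁)))
  set S₂ := ({fun w => min (a w) (b w)} : Set (Ω → ℝ)) ∪ ({fun w => max (a w) (b w)} ∪
    Set.range fun (_ : Unit) w => relu (max (a w) (b w) - c w))
  have hp₂ : (fun w => min (a w) (b w)) ∈ affSpan S₂ := subset_affSpan _ (by simp [S₂])
  have hq₂ : (fun w => max (a w) (b w)) ∈ affSpan S₂ := subset_affSpan _ (by simp [S₂])
  have hr₂ : (fun w => min (max (a w) (b w)) (c w)) ∈ affSpan S₂ :=
    mem_affSpan_congr (sub_mem_affSpan hq₂ (subset_affSpan _ (by simp [S₂] :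
      (fun w => relu (max (a w) (b w) - c w)) ∈ S₂))) fun w => min_eq_sub_relu _ _
  have r₃ := (Reach.carry_one 1 hr₂).union (Reach.layer (κ := Unit) (W := 5) (by simp)
      (fun _ w => min (a w) (b w) - min (max (a w) (b w)) (c w))
      (fun _ => sub_mem_affSpan hp₂ hr₂))
  refine (r₁.trans (r₂.trans (r₃.right ?_)))
  refine Set.singleton_subset_iff.2 (mem_affSpan_congr (add_mem_affSpan
    (subset_affSpan _ (Set.mem_union_left _ rfl))
    (subset_affSpan _ (Set.mem_union_right _ ⟨(), rfl⟩))) fun w => max_eq_add_relu _ _)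

/-- Medians over all shifts recover an approximation that is valid everywhere. -/
theorem Reach.medians {C ι : Type*} [Fintype C] [DecidableEq C] [Fintype ι] {W : ℕ}
    (hW : Fintype.card ((C → Fin 3) × ι) * 7 ≤ W) {G : Ω → C → Fin 3 → Prop}
    (hG : ∀ w c i j, i < j → G w c i ∨ G w c j) {y : ι → Ω → ℝ} {ε : ℝ}
    {v : (C → Fin 3) × ι → Ω → ℝ}
    (hv : ∀ s i w, (∀ c, G w c (s c)) → |v (s, i) w - y i w| ≤ ε) :
    ∃ O : ι → Ω → ℝ, (∀ i w, |O i w - y i w| ≤ ε) ∧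
      Reach W (3 * Fintype.card C) (Set.range v) (Set.range O) := by
  have key : ∀ A : Finset C, ∃ u : (C → Fin 3) × ι → Ω → ℝ,
      (∀ s i w, (∀ c, c ∉ A → G w c (s c)) → |u (s, i) w - y i w| ≤ ε) ∧
      Reach W (3 * A.card) (Set.range v) (Set.range u) := by
    intro A
    induction A using Finset.induction_on with
    | empty => exact ⟨v, fun s i w h => hv s i w fun c => h c (by simp), subset_affSpan _⟩
    | insert a A ha ih =>
      obtain ⟨u, hu, ru⟩ := ih
      refine ⟨fun p w => median₃ (u (Function.update p.1 a 0, p.2) w)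
        (u (Function.update p.1 a 1, p.2) w) (u (Function.update p.1 a 2, p.2) w), ?_, ?_⟩
      · intro s i w h
        have h' : ∀ j, G w a j → |u (Function.update s a j, i) w - y i w| ≤ ε := by
          intro j hj
          refine hu _ _ _ fun c hc => ?_
          rcases eq_or_ne c a with rfl | hca
          · simpa using hj
          · rw [Function.update_of_ne hca]
            exact h c (by simp [hca, hc])
        exact abs_median₃_sub_le (v := fun j => u (Function.update s a j, i) w) fun j j' hj =>
          (hG w a j j' hj).imp (h' j) (h' j')
      · rw [Finset.card_insert_of_notMem ha, mul_add, mul_one]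
        refine ru.trans (((Reach.iUnion fun p : (C → Fin 3) × ι => Reach.median
          (S := Set.range u) (subset_affSpan _ ⟨(Function.update p.1 a 0, p.2), rfl⟩)
          (subset_affSpan _ ⟨(Function.update p.1 a 1, p.2), rfl⟩)
          (subset_affSpan _ ⟨(Function.update p.1 a 2, p.2), rfl⟩)).width hW).right ?_)
        rintro _ ⟨p, rfl⟩
        exact subset_affSpan _ (Set.mem_iUnion.2 ⟨p, rfl⟩)
  obtain ⟨u, hu, ru⟩ := key Finset.univ
  refine ⟨fun i => u (fun _ => 0, i), fun i w => hu _ _ _ fun c hc => absurd (Finset.mem_univ c) hc,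
    ru.right ?_⟩
  rintro _ ⟨i, rfl⟩
  exact subset_affSpan _ ⟨_, rfl⟩

end Medians

section NetworkConversion

variable {d ds : ℕ}

theorem applyLayers_append (ls ls' : List (RecLayer d)) (u : ℕ → Fin d → ℝ) :
    applyLayers (ls ++ ls') u = applyLayers ls' (applyLayers ls u) := by
  simp [applyLayers]

theorem RecLayer.out_of_Wh_eq_zero {ℓ : RecLayer d} (h : ℓ.Wh = 0) (u : ℕ → Fin d → ℝ) (t : ℕ) :
    ℓ.out u t = fun i => relu (ℓ.Wx.mulVec (u t) i + ℓ.b i) := by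
  funext i
  simp [RecLayer.out, RecLayer.state, h]

/-- Coefficients of an element of the affine span of a finite family. -/
theorem exists_coeff_of_mem_affSpan {Ω κ : Type*} [Fintype κ] {h : κ → Ω → ℝ} {g : Ω → ℝ}
    (hg : g ∈ affSpan (Set.range h)) :
    ∃ (c : κ → ℝ) (b : ℝ), ∀ w, g w = ∑ j, c j * h j w + b := by
  unfold affSpan at hg
  obtain ⟨b, z, hz, rfl⟩ := Submodule.mem_span_insert.1 hg
  obtain ⟨c, rfl⟩ := (Submodule.mem_span_range_iff_exists_fun ℝ).1 hz
  exact ⟨c, b, fun w => by simp [add_comm]⟩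

/-- Feedforward ReLU networks are realized by recurrent layers without recurrence. -/
theorem Reach.exists_layers {Ω : Type*} {n : ℕ} {S' : Set (Ω → ℝ)} {h : Fin d → Ω → ℝ}
    (r : Reach d n (Set.range h) S') :
    ∃ (ls : List (RecLayer d)) (h' : Fin d → Ω → ℝ), ls.length = n ∧ (∀ ℓ ∈ ls, ℓ.Wh = 0) ∧
      S' ⊆ affSpan (Set.range h') ∧
      ∀ (u : ℕ → Fin d → ℝ) (t : ℕ) (w : Ω), (∀ j, u t j = h j w) →
        ∀ j, applyLayers ls u t j = h' j w := by
  induction n generalizing h with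
  | zero => exact ⟨[], h, rfl, by simp, r, fun u t w hu => hu⟩
  | succ n ih =>
    obtain ⟨g, hg, r⟩ := r
    obtain ⟨ls, h', hls, hz, hS', hu⟩ := ih r
    choose c b hc using fun j => exists_coeff_of_mem_affSpan (hg j)
    let ℓ : RecLayer d := ⟨0, Matrix.of c, b, 0⟩
    refine ⟨ℓ :: ls, h', by simp [hls], ?_, hS', fun u t w hut => ?_⟩
    · intro ℓ' h
      rcases List.mem_cons.1 h with rfl | h
      · rfl
      · exact hz _ h
    · refine hu (ℓ.out u) t w fun j => ?_
      rw [RecLayer.out_of_Wh_eq_zero rfl, hc]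
      simp [ℓ, Matrix.mulVec, dotProduct, hut]

/-- The recurrent layer that moves the input of slot `2 m + 1` to slot `2 m + 2 * p`, and delays
the content of slot `2 m` by one time step in slot `2 m + 1`; slots `2 m` with `m < p` are
preserved. -/
def delayLayer (d p : ℕ) : RecLayer d where
  Wh := Matrix.of fun i j => if (i : ℕ) % 2 = 1 ∧ (j : ℕ) + 1 = i then 1 else 0
  Wx := Matrix.of fun i j => if (i : ℕ) % 2 = 0 ∧
    (if (i : ℕ) < 2 * p then (j : ℕ) = i else (j : ℕ) + 2 * p = i + 1) then 1 else 0
  b := 0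
  h0 := 0

theorem delayLayer_blockDiag (hds : Even ds) (p : ℕ) : (delayLayer d p).BlockDiag ds := by
  intro i j h
  simp only [delayLayer, Matrix.of_apply]
  refine if_neg fun ⟨hi, hj⟩ => h ?_
  obtain ⟨r, hr⟩ := hds
  rw [← hj]
  have : ds = 2 * r := by omega
  rw [this, ← Nat.div_div_eq_div_mul, ← Nat.div_div_eq_div_mul]
  congr 1
  omega

theorem sum_ite_val_eq {q : ℕ → Prop} [DecidablePred q] {n : ℕ} (hn : n < d)
    (hq : ∀ j, q j ↔ j = n) (u : Fin d → ℝ) :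
    ∑ j : Fin d, (if q j then 1 else 0) * u j = u ⟨n, hn⟩ := by
  rw [Finset.sum_eq_single ⟨n, hn⟩]
  · simp [hq]
  · intro j _ hj
    rw [if_neg fun h => hj (Fin.ext ((hq _).1 h)), zero_mul]
  · simp

theorem delayLayer_out_of_lt {p m : ℕ} (w : ℕ → Fin d → ℝ) (t : ℕ) (hm : m < p)
    (h : 2 * m < d) : (delayLayer d p).out w t ⟨2 * m, h⟩ = relu (w t ⟨2 * m, h⟩) := by
  have h₁ : ∀ v : Fin d → ℝ, (delayLayer d p).Wh.mulVec v ⟨2 * m, h⟩ = 0 := by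
    intro v
    simp [delayLayer, Matrix.mulVec, dotProduct]
  have h₂ : (delayLayer d p).Wx.mulVec (w t) ⟨2 * m, h⟩ = w t ⟨2 * m, h⟩ := by
    simp only [delayLayer, Matrix.mulVec, dotProduct, Matrix.of_apply]
    exact sum_ite_val_eq h (q := fun j => 2 * m % 2 = 0 ∧
      (if 2 * m < 2 * p then j = 2 * m else j + 2 * p = 2 * m + 1))
      (fun j => by rw [if_pos (by omega)]; omega) (w t)
  simp only [RecLayer.out, RecLayer.state, h₁, h₂]
  simp [delayLayer]

theorem delayLayer_out_add {p m : ℕ} (w : ℕ → Fin d → ℝ) (t : ℕ) (h : 2 * (m + p) < d)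
    (h' : 2 * m + 1 < d) :
    (delayLayer d p).out w t ⟨2 * (m + p), h⟩ = relu (w t ⟨2 * m + 1, h'⟩) := by
  have h₁ : ∀ v : Fin d → ℝ, (delayLayer d p).Wh.mulVec v ⟨2 * (m + p), h⟩ = 0 := by
    intro v
    simp [delayLayer, Matrix.mulVec, dotProduct]
  have h₂ : (delayLayer d p).Wx.mulVec (w t) ⟨2 * (m + p), h⟩ = w t ⟨2 * m + 1, h'⟩ := by
    simp only [delayLayer, Matrix.mulVec, dotProduct, Matrix.of_apply]
    exact sum_ite_val_eq h' (q := fun j => 2 * (m + p) % 2 = 0 ∧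
      (if 2 * (m + p) < 2 * p then j = 2 * (m + p) else j + 2 * p = 2 * (m + p) + 1))
      (fun j => by rw [if_neg (by omega)]; omega) (w t)
  simp only [RecLayer.out, RecLayer.state, h₁, h₂]
  simp [delayLayer]

theorem delayLayer_out_odd {p m : ℕ} (w : ℕ → Fin d → ℝ) (t : ℕ) (h : 2 * m + 1 < d) :
    (delayLayer d p).out w t ⟨2 * m + 1, h⟩ =
      relu ((delayLayer d p).state w t ⟨2 * m, Nat.lt_of_succ_lt h⟩) := by
  have h₁ : ∀ v : Fin d → ℝ, (delayLayer d p).Wx.mulVec v ⟨2 * m + 1, h⟩ = 0 := by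
    intro v
    simp [delayLayer, Matrix.mulVec, dotProduct, Nat.add_mod]
  have h₂ : ∀ v : Fin d → ℝ, (delayLayer d p).Wh.mulVec v ⟨2 * m + 1, h⟩ =
      v ⟨2 * m, Nat.lt_of_succ_lt h⟩ := by
    intro v
    simp only [delayLayer, Matrix.mulVec, dotProduct, Matrix.of_apply]
    exact sum_ite_val_eq (Nat.lt_of_succ_lt h) (q := fun j => (2 * m + 1) % 2 = 1 ∧
      j + 1 = 2 * m + 1) (fun j => by omega) v
  simp only [RecLayer.out, RecLayer.state, h₁, h₂]
  simp [delayLayer]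

/-- The states of an iterated delay layer. -/
theorem applyLayers_delayLayer {p : ℕ} {u : ℕ → Fin d → ℝ} (hu : ∀ t j, 0 ≤ u t j) (n : ℕ) :
    (∀ t s m (_ : m < p) (h : 2 * (s * p + m) < d), s = 0 ∨ s + 1 ≤ n →
      applyLayers (List.replicate n (delayLayer d p)) u t ⟨2 * (s * p + m), h⟩ =
        if s ≤ t then u (t - s) ⟨2 * m, by nlinarith⟩ else 0) ∧
    (∀ t s m (_ : m < p) (h : 2 * (s * p + m) + 1 < d), s + 1 ≤ n →
      applyLayers (List.replicate n (delayLayer d p)) u t ⟨2 * (s * p + m) + 1, h⟩ =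
        if s + 1 ≤ t then u (t - (s + 1)) ⟨2 * m, by nlinarith⟩ else 0) := by
  have hrelu : ∀ (P : Prop) [Decidable P] t j, relu (if P then u t j else 0) =
      if P then u t j else 0 := by
    intro P _ t j
    apply relu_of_nonneg
    split_ifs
    exacts [hu t j, le_rfl]
  induction n with
  | zero =>
    refine ⟨fun t s m hm h hs => ?_, fun t s m hm h hs => by omega⟩
    obtain rfl : s = 0 := by omega
    simp [applyLayers]
  | succ n ih =>
    have happ : ∀ t j, applyLayers (List.replicate (n + 1) (delayLayer d p)) u t j =
        (delayLayer d p).out (applyLayers (List.replicate n (delayLayer d p)) u) t j := by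
      intro t j
      rw [List.replicate_succ', applyLayers_append]
      rfl
    obtain ⟨ih₁, ih₂⟩ := ih
    have heven : ∀ t s m (_ : m < p) (h : 2 * (s * p + m) < d), s = 0 ∨ s + 1 ≤ n + 1 →
        applyLayers (List.replicate (n + 1) (delayLayer d p)) u t ⟨2 * (s * p + m), h⟩ =
          if s ≤ t then u (t - s) ⟨2 * m, by nlinarith⟩ else 0 := by
      intro t s m hm h hs
      rw [happ]
      cases s with
      | zero =>
        have := ih₁ t 0 m hm h (Or.inl rfl)
        rw [delayLayer_out_of_lt _ _ (by omega), this, hrelu]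
      | succ s =>
        have e : (s + 1) * p + m = s * p + m + p := by ring
        have h' : 2 * (s * p + m + p) < d := by omega
        have h'' : 2 * (s * p + m) + 1 < d := by omega
        have := ih₂ t s m hm h'' (by omega)
        rw [show (⟨2 * ((s + 1) * p + m), h⟩ : Fin d) = ⟨2 * (s * p + m + p), h'⟩ from
          Fin.ext (congrArg (2 * ·) e), delayLayer_out_add _ _ h' h'', this, hrelu]
    refine ⟨heven, fun t s m hm h hs => ?_⟩
    rw [happ, delayLayer_out_odd]
    cases t with
    | zero => simp [RecLayer.state, delayLayer, relu]
    | succ t =>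
      have := heven t s m hm (by omega) (Or.inr hs)
      rw [happ] at this
      change relu ((delayLayer d p).out _ t _) = _
      rw [this, hrelu]
      simp

theorem abs_clip_sub_le (z : ℝ) {U y : ℝ} (hy : y ∈ Set.Icc (-U) U) :
    |relu (z + U) - relu (z - U) - U - y| ≤ |z - y| := by
  obtain ⟨h₀, h₁⟩ := hy
  have h := le_abs_self (z - y)
  have h' := neg_abs_le (z - y)
  unfold relu
  rcases le_total (z + U) 0 with h₂ | h₂ <;> rcases le_total (z - U) 0 with h₃ | h₃ <;>
    simp only [h₂, h₃, max_eq_left, max_eq_right] <;> rw [abs_le] <;> constructor <;> linarith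

theorem abs_clip_le (z : ℝ) {U : ℝ} (hU : 0 ≤ U) : |relu (z + U) - relu (z - U) - U| ≤ U := by
  unfold relu
  rcases le_total (z + U) 0 with h₂ | h₂ <;> rcases le_total (z - U) 0 with h₃ | h₃ <;>
    simp only [h₂, h₃, max_eq_left, max_eq_right] <;> rw [abs_le] <;> constructor <;> linarith

theorem ofFn_get_cast {α : Type*} {l : List α} {n : ℕ} (h : l.length = n) :
    List.ofFn (fun i : Fin n => l.get (i.cast h.symm)) = l := by
  subst h
  exact List.ofFn_get l

/-- The output stage computing clipped affine functions of the last hidden states. -/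
theorem exists_output_stage {dout : ℕ} (hout : 2 * dout + 1 ≤ d) (c : Fin dout → Fin d → ℝ)
    (b : Fin dout → ℝ) (U : ℝ) :
    ∃ (Wf : Matrix (Fin d) (Fin d) ℝ) (bf : Fin d → ℝ) (Q : Matrix (Fin dout) (Fin d) ℝ),
      ∀ (v : Fin d → ℝ) o, Q.mulVec (fun j => relu (Wf.mulVec v j + bf j)) o =
        relu (∑ j, c o j * v j + b o + U) - relu (∑ j, c o j * v j + b o - U) - U := by
  obtain ⟨e⟩ : Nonempty ((Fin dout ⊕ Fin dout ⊕ Unit) ↪ Fin d) :=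
    Function.Embedding.nonempty_of_card_le (by simp; omega)
  refine ⟨Matrix.of (Function.extend e (Sum.elim c (Sum.elim c 0)) 0),
    Function.extend e (Sum.elim (fun o => b o + U) (Sum.elim (fun o => b o - U) fun _ => 1)) 0,
    Matrix.of fun o => Function.extend e
      (Sum.elim (Pi.single o 1) (Sum.elim (Pi.single o (-1)) fun _ => -U)) 0, fun v o => ?_⟩
  simp only [Matrix.mulVec, dotProduct, Matrix.of_apply]
  rw [← Fintype.sum_of_injective e e.injective (fun q =>
    Sum.elim (Pi.single o 1) (Sum.elim (Pi.single o (-1)) fun _ => -U) q *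
      relu (∑ j, Sum.elim c (Sum.elim c 0) q j * v j +
        Sum.elim (fun o => b o + U) (Sum.elim (fun o => b o - U) fun _ => 1) q))]
  · simp only [Fintype.sum_sum_type, Sum.elim_inl, Sum.elim_inr, Pi.single_apply, ite_mul,
      one_mul, neg_mul, zero_mul, Finset.sum_ite_eq', Finset.mem_univ, if_true,
      Finset.univ_unique, Finset.sum_const, Finset.card_singleton, Pi.zero_apply, one_smul,
      smul_zero, zero_add]
    rw [show relu 1 = 1 from relu_of_nonneg zero_le_one]
    simp only [add_assoc, add_sub_assoc]
    ring
  · intro j hj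
    rw [Function.extend_apply' _ _ _ hj]
    simp
  · intro q
    simp only [e.injective.extend_apply]

theorem exists_mem_paraClass {din dout T n : ℕ} {U : ℝ} (hU : 0 ≤ U) (hT : 0 < T)
    (hds : Even ds) {g : Fin dout → cube T din → ℝ}
    (r : Reach d n (cubeCoords T din) (Set.range g)) (hin : 2 * (T * din) ≤ d)
    (hout : 2 * dout + 1 ≤ d) :
    ∃ φ ∈ ParaClass din dout d ds (T + n) T U, ∀ X (hX : X ∈ cube T din) i,
      ∀ y ∈ Set.Icc (-U) U, |φ X i - y| ≤ |g i ⟨X, hX⟩ - y| := by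
  let P : Matrix (Fin d) (Fin din) ℝ := Matrix.of fun j i => if (j : ℕ) = 2 * i then 1 else 0
  have hP : ∀ j i, 0 ≤ P j i := by
    intro j i
    simp only [P, Matrix.of_apply]
    split_ifs <;> norm_num
  let G := List.replicate T (delayLayer d din)
  let h : Fin d → cube T din → ℝ := fun j x =>
    applyLayers G (fun t => P.mulVec (extendInput x.1 t)) (T - 1) j
  have hext : ∀ (x : cube T din) t i, 0 ≤ extendInput x.1 t i := by
    intro x t i
    unfold extendInput
    split_ifs with ht
    · exact (x.2 ⟨t, ht⟩ i).1
    · exact le_rfl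
  have hcoords : cubeCoords T din ⊆ affSpan (Set.range h) := by
    rintro _ ⟨⟨t, i⟩, rfl⟩
    have hs : T - 1 - (t : ℕ) + 1 ≤ T := by omega
    have hlt : 2 * ((T - 1 - t) * din + i) < d := by
      have := i.2
      have := Nat.mul_le_mul_right din hs
      rw [Nat.succ_mul] at this
      omega
    refine mem_affSpan_congr (subset_affSpan _ ⟨⟨_, hlt⟩, rfl⟩) fun x => ?_
    have h₁ := (applyLayers_delayLayer (p := din) (u := fun t => P.mulVec (extendInput x.1 t))
      (fun t j => show 0 ≤ ∑ i, P j i * extendInput x.1 t i from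
        Finset.sum_nonneg fun i _ => mul_nonneg (hP j i) (hext x t i)) T).1
      (T - 1) (T - 1 - t) i i.2 hlt (Or.inr hs)
    simp only [h, G]
    rw [h₁, if_pos (by omega)]
    have ht : T - 1 - (T - 1 - (t : ℕ)) = t := by omega
    rw [ht]
    simp only [P, Matrix.mulVec, dotProduct, Matrix.of_apply]
    rw [sum_ite_val_eq (q := fun j => 2 * (i : ℕ) = 2 * j) i.2 (fun j => by omega)]
    simp [extendInput]
  obtain ⟨ls, h', hls, hz, hg, hu⟩ := (r.left hcoords).exists_layers
  choose c b hc using fun i => exists_coeff_of_mem_affSpan (hg ⟨i, rfl⟩)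
  obtain ⟨Wf, bf, Q, hQ⟩ := exists_output_stage hout c b U
  have hlen : (G ++ ls).length = T + n := by simp [G, hls]
  have hbd : ∀ ℓ ∈ G ++ ls, ℓ.BlockDiag ds := by
    intro ℓ hℓ
    rcases List.mem_append.1 hℓ with hℓ | hℓ
    · rw [List.eq_of_mem_replicate hℓ]
      exact delayLayer_blockDiag hds din
    · intro i j _
      rw [hz ℓ hℓ]
      rfl
  let net : ParaNet din dout d ds (T + n) :=
    { P := P
      layer := fun i => (G ++ ls).get (i.cast hlen.symm)
      blockdiag := fun i => hbd _ (List.get_mem _ _)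
      Wf := Wf
      bf := bf
      Q := Q }
  have hnet : ∀ X t i, ∃ z, net.forward X t i = relu (z + U) - relu (z - U) - U := by
    intro X t i
    exact ⟨_, hQ _ _⟩
  refine ⟨fun X => net.forward (extendInput X) (T - 1), ⟨net, ?_, fun X => rfl⟩, ?_⟩
  · intro X t _ i
    obtain ⟨z, hz⟩ := hnet (extendInput X) t i
    rw [hz]
    exact abs_clip_le z hU
  · intro X hX i y hy
    have e : net.forward (extendInput X) (T - 1) i =
        relu (g i ⟨X, hX⟩ + U) - relu (g i ⟨X, hX⟩ - U) - U := by
      simp only [ParaNet.forward, net]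
      rw [ofFn_get_cast hlen, applyLayers_append, hQ, hc]
      have := hu (applyLayers G fun t => P.mulVec (extendInput X t)) (T - 1) ⟨X, hX⟩ fun j => rfl
      simp only [this]
    exact (congrArg (fun z => |z - y|) e).trans_le (abs_clip_sub_le _ hy)

end NetworkConversion

section Estimates

theorem seven_thirds_pow_le (k : ℕ) : (7 / 3 : ℝ) ^ (k + 1) ≤ 8 * k.factorial := by
  match k with
  | 0 => norm_num
  | 1 => norm_num
  | k + 2 =>
    induction k with
    | zero => norm_num [Nat.factorial]
    | succ k ih =>
      rw [pow_succ, show k + 1 + 2 = k + 2 + 1 from rfl, Nat.factorial_succ]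
      have h : (7 / 3 : ℝ) ≤ ((k + 2 + 1 : ℕ) : ℝ) := by push_cast; linarith [k.cast_nonneg (α := ℝ)]
      rw [Nat.cast_mul]
      nlinarith [(k + 2).factorial.cast_nonneg (α := ℝ), mul_le_mul_of_nonneg_left h
        ((k + 2).factorial.cast_nonneg (α := ℝ))]

theorem four_rpow_le {D : ℕ} (hD : 3 ≤ D) {k : ℕ} {β : ℝ} (hβ : 0 < β) (hk : β ≤ k + 1) :
    (4 : ℝ) ^ β ≤ 8 * k.factorial * (D : ℝ) ^ (β / 2) := by
  have hD' : (3 : ℝ) ≤ D := by exact_mod_cast hD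
  calc (4 : ℝ) ^ β = (16 : ℝ) ^ (β / 2) := by
        rw [show (16 : ℝ) = 4 ^ (2 : ℝ) by norm_num, ← Real.rpow_mul (by norm_num)]
        congr 1; ring
    _ = (16 / 3 : ℝ) ^ (β / 2) * 3 ^ (β / 2) := by
        rw [← Real.mul_rpow (by norm_num) (by norm_num)]; norm_num
    _ ≤ ((7 / 3 : ℝ) ^ (2 : ℝ)) ^ (β / 2) * (D : ℝ) ^ (β / 2) := by
        gcongr
        norm_num
    _ = (7 / 3 : ℝ) ^ β * (D : ℝ) ^ (β / 2) := by
        rw [← Real.rpow_mul (by norm_num)]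
        congr 2; ring
    _ ≤ 8 * k.factorial * (D : ℝ) ^ (β / 2) := by
        gcongr
        refine (Real.rpow_le_rpow_of_exponent_le (by norm_num) hk).trans ?_
        have := seven_thirds_pow_le k
        rwa [← Real.rpow_natCast, Nat.cast_succ] at this

/-- The `β`-th power of the grid step in terms of the size of the network. -/
theorem grid_step_rpow_le {D x M k : ℕ} (hD : 0 < D) (hx : 0 < x) (hM : 0 < M)
    (h : 4 * x < (M + 1) ^ D) {β : ℝ} (hβ : 0 < β) (hk : β ≤ k + 1) :
    (1 / (M : ℝ) ^ 2) ^ β ≤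
      8 * k.factorial * (D : ℝ) ^ (β / 2) * (x : ℝ) ^ (-(2 * β) / (D : ℝ)) := by
  have hx' : (1 : ℝ) ≤ x := by exact_mod_cast hx
  have hM' : (1 : ℝ) ≤ M := by exact_mod_cast hM
  have hD' : (1 : ℝ) ≤ D := by exact_mod_cast hD
  have hf : (1 : ℝ) ≤ k.factorial := by exact_mod_cast Nat.factorial_pos k
  set y : ℝ := (x : ℝ) ^ ((D : ℝ)⁻¹) with hy
  have hy0 : 0 < y := by positivity
  have hyD : y ^ D = x := Real.rpow_inv_natCast_pow (by positivity) hD.ne'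
  have hE : (x : ℝ) ^ (-(2 * β) / (D : ℝ)) = (1 / y ^ 2) ^ β := by
    rw [one_div, ← Real.rpow_natCast, ← Real.rpow_neg hy0.le, ← Real.rpow_mul hy0.le, hy,
      ← Real.rpow_mul (by positivity)]
    congr 1
    push_cast
    ring
  have h2 : (4 * x : ℝ) < (2 * M) ^ D := by
    have h₁ : (4 * x : ℝ) < (M + 1) ^ D := by exact_mod_cast h
    refine h₁.trans_le (pow_le_pow_left₀ (by positivity) (by linarith) _)
  rw [hE]
  rcases le_or_gt 3 D with h3 | h3
  · have hle : y ≤ 2 * M := by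
      refine le_of_pow_le_pow_left₀ hD.ne' (by positivity) ?_
      rw [hyD]
      linarith
    calc (1 / (M : ℝ) ^ 2) ^ β ≤ (4 * (1 / y ^ 2)) ^ β := by
          refine Real.rpow_le_rpow (by positivity) ?_ hβ.le
          rw [mul_one_div, div_le_div_iff₀ (by positivity) (by positivity)]
          nlinarith
      _ = 4 ^ β * (1 / y ^ 2) ^ β := Real.mul_rpow (by norm_num) (by positivity)
      _ ≤ _ := mul_le_mul_of_nonneg_right (four_rpow_le h3 hβ hk) (by positivity)
  · have hle : y ≤ M := by
      refine le_of_pow_le_pow_left₀ hD.ne' (by positivity) ?_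
      rw [hyD]
      rw [mul_pow] at h2
      have : (2 : ℝ) ^ D ≤ 2 ^ 2 := pow_le_pow_right₀ (by norm_num) (by omega)
      have hp : (0 : ℝ) < (M : ℝ) ^ D := by positivity
      nlinarith
    have h₁ : (1 / (M : ℝ) ^ 2) ^ β ≤ (1 / y ^ 2) ^ β := by
      refine Real.rpow_le_rpow (by positivity) ?_ hβ.le
      gcongr
    have h₂ : (1 : ℝ) ≤ (D : ℝ) ^ (β / 2) := Real.one_le_rpow hD' (by positivity)
    refine h₁.trans (le_mul_of_one_le_left (by positivity) ?_)
    nlinarith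

theorem inv_sq_pow_le {D x k : ℕ} (hD : 0 < D) (hx : 0 < x) {β : ℝ} (hβ : 0 < β)
    (hk : β ≤ k + 1) :
    (1 / (x : ℝ) ^ 2) ^ (k + 1) ≤ (x : ℝ) ^ (-(2 * β) / (D : ℝ)) := by
  have hx' : (1 : ℝ) ≤ x := by exact_mod_cast hx
  have hD' : (1 : ℝ) ≤ D := by exact_mod_cast hD
  have e : (1 / (x : ℝ) ^ 2) ^ (k + 1) = (x : ℝ) ^ (-(2 * ((k : ℝ) + 1))) := by
    rw [Real.rpow_neg (by positivity), one_div, inv_pow, ← pow_mul, ← Real.rpow_natCast]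
    push_cast
    rfl
  rw [e]
  refine Real.rpow_le_rpow_of_exponent_le hx' ?_
  rw [neg_div, neg_le_neg_iff]
  exact (div_le_self (by positivity) hD').trans (by linarith)

theorem three_le_clog {n : ℕ} (hn : 0 < n) : 3 ≤ Nat.clog 2 (8 * n) := by
  by_contra! h
  have h₁ := Nat.le_pow_clog (b := 2) (by norm_num) (8 * n)
  have h₂ : 2 ^ Nat.clog 2 (8 * n) ≤ 2 ^ 2 := Nat.pow_le_pow_right (by norm_num) (by omega)
  omega

theorem half_pow_clog_le {N L : ℕ} (hN : 0 < N) (hL : 0 < L) (k : ℕ) :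
    (1 / 2 : ℝ) ^ (2 * (k + 1) * Nat.clog 2 (8 * N) * Nat.clog 2 (8 * L)) ≤
      (1 / ((N * L : ℕ) : ℝ) ^ 2) ^ (k + 1) := by
  set a := Nat.clog 2 (8 * N) with ha'
  set b := Nat.clog 2 (8 * L) with hb'
  have ha : 3 ≤ a := three_le_clog hN
  have hb : 3 ≤ b := three_le_clog hL
  have hNa : N ≤ 2 ^ a := by
    have := Nat.le_pow_clog (b := 2) (by norm_num) (8 * N)
    rw [← ha'] at this
    omega
  have hLb : L ≤ 2 ^ b := by
    have := Nat.le_pow_clog (b := 2) (by norm_num) (8 * L)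
    rw [← hb'] at this
    omega
  have hab : N * L ≤ 2 ^ (a * b) := by
    refine (Nat.mul_le_mul hNa hLb).trans ?_
    rw [← pow_add]
    exact Nat.pow_le_pow_right (by norm_num) (by nlinarith)
  have hab' : ((N * L : ℕ) : ℝ) ≤ 2 ^ (a * b) := by exact_mod_cast hab
  have hpos : (0 : ℝ) < ((N * L : ℕ) : ℝ) := by exact_mod_cast Nat.mul_pos hN hL
  have e : (1 / 2 : ℝ) ^ (2 * (k + 1) * a * b) = (1 / ((2 : ℝ) ^ (a * b)) ^ 2) ^ (k + 1) := by
    rw [← pow_mul, ← _root_.one_div_pow, ← pow_mul]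
    congr 1
    ring
  rw [e]
  gcongr

theorem depth_le {κ k L b D T : ℕ} (hk : k ≤ κ) (hL : 0 < L) (hb : 3 ≤ b) (hT : 0 < T)
    (hTD : T ≤ D) :
    T + (1 + (4 * L + 4 * L + (b * (3 * (4 * L) + 2) + (k + 1) * ((k + 1) * L + 1))) + 3 * D) ≤
      42 * (κ + 1) ^ 2 * L * b + 6 * D := by
  have h₁ : (k + 1) * ((k + 1) * L + 1) ≤ 2 * ((κ + 1) ^ 2 * L) := by
    calc (k + 1) * ((k + 1) * L + 1) ≤ (κ + 1) * ((κ + 1) * L + (κ + 1) * L) := by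
          gcongr
          exact Nat.mul_pos (by omega) hL
      _ = _ := by ring
  have h₂ : 3 * ((κ + 1) ^ 2 * L) ≤ (κ + 1) ^ 2 * L * b := by
    rw [mul_comm]; exact Nat.mul_le_mul_left _ hb
  have h₃ : L * b ≤ (κ + 1) ^ 2 * L * b := by
    rw [mul_assoc]; exact Nat.le_mul_of_pos_left _ (by positivity)
  nlinarith

theorem width_le {κ k N a D : ℕ} (hk : k ≤ κ) (hN : 0 < N) (ha : 3 ≤ a) (hD : 0 < D) :
    max (D * (2 * N + 10)) ((k + 1) * D ^ k *
      (max (2 * (k + 1) * a * (4 * N + 17)) (3 * N + 28) + 2 * D)) ≤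
      76 * (κ + 1) ^ 2 * D ^ (κ + 1) * N * a := by
  have h₁ : 76 * (k + 1) ^ 2 * D ^ (k + 1) * N * a ≤ 76 * (κ + 1) ^ 2 * D ^ (κ + 1) * N * a := by
    gcongr
  refine le_trans ?_ h₁
  have hDk : 1 ≤ D ^ k := Nat.one_le_pow _ _ hD
  have hc : 76 * (k + 1) ^ 2 * D ^ (k + 1) * N * a =
      (k + 1) * D ^ k * (76 * ((k + 1) * D * (N * a))) := by ring
  have hkD : 1 ≤ (k + 1) * D ^ k := Nat.mul_pos (by omega) hDk
  have hNa : 3 * N ≤ N * a := by nlinarith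
  have hDN : D * (N * a) ≤ (k + 1) * D * (N * a) := by
    rw [mul_assoc]; exact Nat.le_mul_of_pos_left _ (by omega)
  rw [hc]
  refine max_le ?_ (Nat.mul_le_mul_left _ ?_)
  · refine le_trans ?_ (Nat.le_mul_of_pos_left _ hkD)
    nlinarith
  · have h₂ : 2 * D ≤ (k + 1) * D * (N * a) := by nlinarith
    have h₃ : 3 * N + 28 ≤ 31 * ((k + 1) * D * (N * a)) := by nlinarith
    have h₄ : 2 * (k + 1) * a * (4 * N + 17) ≤ 42 * ((k + 1) * D * (N * a)) := by
      have : 4 * N + 17 ≤ 21 * (D * N) := by nlinarith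
      calc 2 * (k + 1) * a * (4 * N + 17) ≤ 2 * (k + 1) * a * (21 * (D * N)) := by gcongr
        _ = _ := by ring
    omega

end Estimates

section Assembly

theorem exists_modulus {T din dout k : ℕ} {ω U η : ℝ} {f : (Fin T → Fin din → ℝ) → Fin dout → ℝ}
    (hω : 0 < ω) (hη : 0 < η)
    (hf : ∀ i, (∀ l : List (Fin T × Fin din), l.length < k →
        DifferentiableOn ℝ (dirDerivList (cube T din) (l.map coordVec) fun y => f y i)
          (cube T din)) ∧
      (∀ l : List (Fin T × Fin din), l.length ≤ k → ∀ x ∈ cube T din,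
        |dirDerivList (cube T din) (l.map coordVec) (fun y => f y i) x| ≤ U) ∧
      (∀ l : List (Fin T × Fin din), l.length = k → ∀ x ∈ cube T din, ∀ y ∈ cube T din,
        |dirDerivList (cube T din) (l.map coordVec) (fun y => f y i) x -
          dirDerivList (cube T din) (l.map coordVec) (fun y => f y i) y| ≤
            U * ‖x - y‖ ^ ω)) :
    ∃ δ > 0, δ ≤ 1 / 3 ∧ ∀ i, ∀ x ∈ cube T din, ∀ y ∈ cube T din, ‖x - y‖ ≤ δ →
      |f x i - f y i| ≤ η := by
  have hc : ContinuousOn f (cube T din) := by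
    refine continuousOn_pi.2 fun i => ?_
    obtain ⟨h₁, -, h₃⟩ := hf i
    rcases Nat.eq_zero_or_pos k with rfl | hk
    · exact continuousOn_of_abs_sub_le_rpow hω (h₃ [] rfl)
    · exact (h₁ [] hk).continuousOn
  obtain ⟨δ, hδ, h⟩ := Metric.uniformContinuousOn_iff.1
    (isCompact_cube.uniformContinuousOn_of_continuous hc) η hη
  refine ⟨min (δ / 2) (1 / 3), by positivity, min_le_right _ _, fun i x hx y hy hxy => ?_⟩
  have h₁ : dist x y < δ := by
    rw [dist_eq_norm]
    linarith [hxy.trans (min_le_left _ _)]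
  have h₂ := (dist_le_pi_dist (f x) (f y) i).trans (h x hx y hy h₁).le
  rwa [Real.dist_eq] at h₂

theorem error_le {κ k : ℕ} {D E U β : ℝ} (hk : k ≤ κ) (hD : 1 ≤ D) (hE : 0 ≤ E) (hU : 0 ≤ U)
    {c r : ℝ} (hc : c ≤ (k + 1) * D ^ k) (hr : r ≤ 8 * k.factorial * D ^ (β / 2) * E)
    (hβ : 0 ≤ β) :
    c * (U * (3 * (k + 1) * E)) + U * (D ^ k / k.factorial * r) + (k + 1) ^ 2 * D ^ k * U * E ≤
      19 * U * ((κ : ℝ) + 1) ^ 2 * D ^ ((κ : ℝ) + max β 1 / 2) * E := by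
  have hf : (0 : ℝ) < k.factorial := by positivity
  have h₁ : (1 : ℝ) ≤ D ^ (β / 2) := Real.one_le_rpow hD (by positivity)
  have h₂ : c * (U * (3 * (k + 1) * E)) ≤ (k + 1) * D ^ k * (U * (3 * (k + 1) * E)) := by
    gcongr
  have h₃ : U * (D ^ k / k.factorial * r) ≤
      U * (D ^ k / k.factorial * (8 * k.factorial * D ^ (β / 2) * E)) := by
    gcongr
  have h₄ : U * (D ^ k / k.factorial * (8 * k.factorial * D ^ (β / 2) * E)) =
      8 * (U * D ^ k * D ^ (β / 2) * E) := by
    field_simp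
  have hA : 0 ≤ U * D ^ k * E := by positivity
  have h₅ : U * D ^ k * E ≤ U * D ^ k * D ^ (β / 2) * E := by
    rw [mul_right_comm _ (D ^ (β / 2))]
    exact le_mul_of_one_le_right hA h₁
  have hk1 : (1 : ℝ) ≤ (k + 1) ^ 2 := one_le_pow₀ (by linarith [k.cast_nonneg (α := ℝ)])
  have h₆ : D ^ k * D ^ (β / 2) ≤ D ^ ((κ : ℝ) + max β 1 / 2) := by
    rw [← Real.rpow_natCast, ← Real.rpow_add (by positivity)]
    refine Real.rpow_le_rpow_of_exponent_le hD (add_le_add (by exact_mod_cast hk) ?_)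
    have := le_max_left β 1
    linarith
  set B := U * D ^ k * D ^ (β / 2) * E with hB
  have hB0 : 0 ≤ B := by positivity
  calc _ ≤ 12 * ((k + 1) ^ 2 * B) := by
        rw [h₄] at h₃
        have e₁ : (k + 1) * D ^ k * (U * (3 * (k + 1) * E)) =
          3 * ((k + 1) ^ 2 * (U * D ^ k * E)) := by ring
        have e₂ : (k + 1) ^ 2 * D ^ k * U * E = (k + 1) ^ 2 * (U * D ^ k * E) := by ring
        have e₃ : ((k : ℝ) + 1) ^ 2 * (U * D ^ k * E) ≤ (k + 1) ^ 2 * B := by gcongr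
        have e₄ : B ≤ (k + 1) ^ 2 * B := le_mul_of_one_le_left hB0 hk1
        linarith
    _ ≤ 19 * ((k + 1) ^ 2 * B) := by
        have : 0 ≤ ((k : ℝ) + 1) ^ 2 * B := by positivity
        linarith
    _ = 19 * U * (k + 1) ^ 2 * (D ^ k * D ^ (β / 2)) * E := by rw [hB]; ring
    _ ≤ _ := by gcongr

theorem exists_grid_size {D x : ℕ} (hD : 0 < D) (hx : 0 < x) :
    ∃ M, 0 < M ∧ M ^ D ≤ 4 * x ∧ 4 * x < (M + 1) ^ D ∧ M ≤ 4 * x := by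
  have h : Nat.nthRoot D (4 * x) ^ D ≤ 4 * x := (Nat.le_nthRoot_iff hD.ne').1 le_rfl
  refine ⟨Nat.nthRoot D (4 * x), (Nat.le_nthRoot_iff hD.ne').2 ?_, h,
    Nat.lt_pow_nthRoot_add_one hD.ne' _, (Nat.le_self_pow hD.ne' _).trans h⟩
  change 1 ^ D ≤ _
  rw [one_pow]
  omega

/-- Approximation of Hölder functions on the cube by feedforward ReLU networks. -/
theorem Reach.holder {T din dout : ℕ} (hdin : 0 < din) (hT : 0 < T) (hdout : 0 < dout)
    {β U : ℝ} (hβ : 0 < β) (hU : 0 < U) {f : (Fin T → Fin din → ℝ) → Fin dout → ℝ}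
    (hf : MemHolderClass T din dout β U f) {N L : ℕ} (hN : 0 < N) (hL : 0 < L) {d : ℕ}
    (hd : 76 * (⌊β⌋₊ + 1) ^ 2 * 3 ^ (T * din) * (T * din) ^ (⌊β⌋₊ + 1) * dout * N *
      Nat.clog 2 (8 * N) ≤ d) :
    ∃ (n : ℕ) (g : Fin dout → cube T din → ℝ),
      T + n ≤ 42 * (⌊β⌋₊ + 1) ^ 2 * L * Nat.clog 2 (8 * L) + 6 * (T * din) ∧
      (∀ i x, |g i x - f x.1 i| ≤ 19 * U * ((⌊β⌋₊ : ℝ) + 1) ^ 2 *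
        ((T * din : ℕ) : ℝ) ^ ((⌊β⌋₊ : ℝ) + max β 1 / 2) *
        ((N * L : ℕ) : ℝ) ^ (-(2 * β) / ((T * din : ℕ) : ℝ))) ∧
      Reach d n (cubeCoords T din) (Set.range g) := by
  classical
  obtain ⟨k, ω, hβk, hω₀, hω₁, hb⟩ := hf.bounds
  have hkκ : k ≤ ⌊β⌋₊ := Nat.le_floor (by linarith)
  have hk1 : β ≤ k + 1 := by linarith
  generalize ⌊β⌋₊ = κ at *
  have hcard : Fintype.card (Fin T × Fin din) = T * din := by simp
  have hD : 0 < T * din := Nat.mul_pos hT hdin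
  have hTD : T ≤ T * din := Nat.le_mul_of_pos_right _ hdin
  have hι := card_multiindex_le (Fin T × Fin din) (by rw [hcard]; exact hD) k
  have ha := three_le_clog hN
  have hclog := half_pow_clog_le hN hL k
  have hb3 := three_le_clog hL
  generalize Nat.clog 2 (8 * N) = a at *
  generalize Nat.clog 2 (8 * L) = b at *
  have hW := width_le hkκ hN ha hD
  have hE := inv_sq_pow_le hD (Nat.mul_pos hN hL) hβ hk1
  obtain ⟨M, hM0, hM₁, hM₂, hMle⟩ := exists_grid_size hD (Nat.mul_pos hN hL)
  have h4 : 4 * (N * L) = N * (4 * L) := by ring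
  have hgrid := grid_step_rpow_le hD (Nat.mul_pos hN hL) hM0 hM₂ hβ hk1
  set E : ℝ := ((N * L : ℕ) : ℝ) ^ (-(2 * β) / ((T * din : ℕ) : ℝ)) with hE'
  have hNL : (0 : ℝ) < ((N * L : ℕ) : ℝ) := by exact_mod_cast Nat.mul_pos hN hL
  have hE0 : 0 < E := by positivity
  have hD1 : (1 : ℝ) ≤ ((T * din : ℕ) : ℝ) := by exact_mod_cast hD
  set η : ℝ := (k + 1) ^ 2 * ((T * din : ℕ) : ℝ) ^ k * U * E with hη
  obtain ⟨δ, hδ, hδ', hmod⟩ := exists_modulus (η := η) hω₀ (by positivity) hb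
  set W := 76 * (κ + 1) ^ 2 * (T * din) ^ (κ + 1) * N * a with hWdef
  have hW₁ : Fintype.card (Fin T × Fin din) * (2 * N + 10) ≤ W := by
    rw [hcard]
    exact (le_max_left _ _).trans hW
  have hW₂ : Fintype.card (Σ j : Fin (k + 1), Fin j → Fin T × Fin din) *
      (max (2 * (k + 1) * a * (4 * N + 17)) (3 * N + 28) +
        2 * Fintype.card (Fin T × Fin din)) ≤ W := by
    refine le_trans ?_ ((le_max_right _ _).trans hW)
    rw [hcard] at hι ⊢
    exact Nat.mul_le_mul_right _ hι
  have hWd : 3 ^ (T * din) * dout * W ≤ d := by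
    refine le_trans (le_of_eq ?_) hd
    rw [hWdef]
    ring
  have h3 : 1 ≤ 3 ^ (T * din) * dout := Nat.mul_pos (by positivity) hdout
  have hcard' : Fintype.card ((Fin T × Fin din → Fin 3) × Fin dout) = 3 ^ (T * din) * dout := by
    simp
  have hWd' : W ≤ d := (Nat.le_mul_of_pos_left _ h3).trans hWd
  obtain ⟨v, hv, rv⟩ := Reach.holder_shifts (m := 4 * L) hU hβk hω₀ hb hN hL hM0
    (by rw [hcard, ← h4]; exact hM₁) (h4 ▸ hMle) hδ hmod (k + 1) (2 * (k + 1) * a) b (E := E)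
    hE (hclog.trans hE) hW₁ hW₂ (W' := d) (by
      rw [hcard] at hW₁ ⊢
      nlinarith) (by rwa [hcard'])
  obtain ⟨O, hO, rO⟩ := Reach.medians (W := d) (by
      rw [hcard']
      refine le_trans (Nat.mul_le_mul_left _ ?_) hWd
      rw [hcard] at hW₁
      nlinarith)
    (G := fun (x : cube T din) (c : Fin T × Fin din) s =>
      AwayFromGrid (M ^ 2) δ (clipShift (gridShift (M ^ 2) δ s) (x.1 c.1 c.2)))
    (fun x c i j hij => awayFromGrid_or hδ hδ' _ hij) (y := fun i x => f x.1 i) hv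
  rw [hcard] at rO
  refine ⟨_, O, depth_le hkκ hL hb3 hT hTD, fun i x => (hO i x).trans ?_, rv.trans rO⟩
  have hιr : (Fintype.card (Σ j : Fin (k + 1), Fin j → Fin T × Fin din) : ℝ) ≤
      (k + 1) * ((T * din : ℕ) : ℝ) ^ k := by
    rw [hcard] at hι
    exact_mod_cast hι
  rw [hcard]
  exact error_le hkκ hD1 hE0.le hU.le hιr hgrid hβ.le

end Assembly

/-- **Approximation error of deep ParaRNNs.** If `f ∈ H^β_{din·T, dout}([0,1]^{din×T}, U)`
then for any `I, J ∈ ℕ⁺` there is a ParaRNN function `φ ∈ F^{(T)}_{din,dout,d,ds,L,U}` with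
depth `L = 42(⌊β⌋+1)² I ⌈log₂(8I)⌉ + 6 din T` and width
`d = 76(⌊β⌋+1)² 3^{din T} din^{⌊β⌋+2} dout T^{⌊β⌋+1} J ⌈log₂(8J)⌉ + ds` such that
`sup_{X ∈ [0,1]^{din×T}} ‖φ(X) − f(X)‖_∞
  ≤ 19 U (⌊β⌋+1)² (din T)^{⌊β⌋ + (β ∨ 1)/2} (JI)^{−2β/(din T)}`. -/
theorem stmt10 (din dout T ds : ℕ)
    (hdin : 0 < din) (hdout : 0 < dout) (hT : 0 < T) (hds0 : 0 < ds) (hds : Even ds)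
    (β U : ℝ) (hβ : 0 < β)
    (f : (Fin T → Fin din → ℝ) → Fin dout → ℝ)
    (hf : MemHolderClass T din dout β U f)
    (I J : ℕ) (hI : 0 < I) (hJ : 0 < J) :
    ∃ φ ∈ ParaClass din dout
        (76 * (⌊β⌋₊ + 1) ^ 2 * 3 ^ (din * T) * din ^ (⌊β⌋₊ + 2) * dout * T ^ (⌊β⌋₊ + 1)
          * J * Nat.clog 2 (8 * J) + ds)
        ds
        (42 * (⌊β⌋₊ + 1) ^ 2 * I * Nat.clog 2 (8 * I) + 6 * din * T)
        T U,
      ∀ X ∈ cube T din, ∀ i : Fin dout,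
        |φ X i - f X i| ≤
          19 * U * ((⌊β⌋₊ : ℝ) + 1) ^ 2
            * ((din * T : ℕ) : ℝ) ^ ((⌊β⌋₊ : ℝ) + max β 1 / 2)
            * ((J * I : ℕ) : ℝ) ^ (-(2 * β) / ((din * T : ℕ) : ℝ)) := by
  have hbd : ∀ i, ∀ X ∈ cube T din, |f X i| ≤ U := by
    obtain ⟨k, ω, -, -, -, hb⟩ := hf.bounds
    exact fun i X hX => (hb i).2.1 [] (Nat.zero_le k) X hX
  have hU : 0 ≤ U := (abs_nonneg _).trans
    (hbd ⟨0, hdout⟩ (fun _ _ => 0) fun _ _ => ⟨le_rfl, zero_le_one⟩)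
  set d := 76 * (⌊β⌋₊ + 1) ^ 2 * 3 ^ (din * T) * din ^ (⌊β⌋₊ + 2) * dout * T ^ (⌊β⌋₊ + 1)
    * J * Nat.clog 2 (8 * J) + ds with hd
  have hdle : 76 * (⌊β⌋₊ + 1) ^ 2 * 3 ^ (T * din) * (T * din) ^ (⌊β⌋₊ + 1) * dout * J *
      Nat.clog 2 (8 * J) ≤ d := by
    refine le_trans ?_ (Nat.le_add_right _ _)
    calc _ = (76 * (⌊β⌋₊ + 1) ^ 2 * 3 ^ (din * T) * din ^ (⌊β⌋₊ + 1) * dout * T ^ (⌊β⌋₊ + 1)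
          * J * Nat.clog 2 (8 * J)) := by rw [mul_comm T din]; ring
      _ ≤ _ := by
        gcongr
        omega
  have hlow : 76 * (T * din * dout) ≤ d := by
    refine le_trans ?_ hdle
    have h₁ : 1 ≤ (⌊β⌋₊ + 1) ^ 2 := Nat.one_le_pow _ _ (by omega)
    have h₂ : 1 ≤ 3 ^ (T * din) := Nat.one_le_pow _ _ (by omega)
    have h₃ : T * din ≤ (T * din) ^ (⌊β⌋₊ + 1) := Nat.le_self_pow (by omega) _
    have h₄ : 1 ≤ Nat.clog 2 (8 * J) := le_trans (by omega) (three_le_clog hJ)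
    calc 76 * (T * din * dout) = 76 * 1 * 1 * (T * din) * dout * 1 * 1 := by ring
      _ ≤ _ := by gcongr; omega
  have hTdin : 1 ≤ T * din := Nat.mul_pos hT hdin
  have hin : 2 * (T * din) ≤ d := by nlinarith
  have hout : 2 * dout + 1 ≤ d := by nlinarith
  obtain ⟨n, g, hn, hg, rg⟩ : ∃ (n : ℕ) (g : Fin dout → cube T din → ℝ),
      T + n ≤ 42 * (⌊β⌋₊ + 1) ^ 2 * I * Nat.clog 2 (8 * I) + 6 * (T * din) ∧
      (∀ i x, |g i x - f x.1 i| ≤ 19 * U * ((⌊β⌋₊ : ℝ) + 1) ^ 2 *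
        ((T * din : ℕ) : ℝ) ^ ((⌊β⌋₊ : ℝ) + max β 1 / 2) *
        ((J * I : ℕ) : ℝ) ^ (-(2 * β) / ((T * din : ℕ) : ℝ))) ∧
      Reach d n (cubeCoords T din) (Set.range g) := by
    rcases hU.eq_or_lt with rfl | hU
    · refine ⟨0, fun _ _ => 0, ?_, fun i x => ?_, ?_⟩
      · have : T ≤ T * din := Nat.le_mul_of_pos_right _ hdin
        omega
      · have := abs_nonpos_iff.1 (hbd i x.1 x.2)
        simp [this]
      · rintro _ ⟨i, rfl⟩
        exact const_mem_affSpan _ 0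
    · exact Reach.holder hdin hT hdout hβ hU hf hJ hI hdle
  obtain ⟨r, hr⟩ := Nat.exists_eq_add_of_le hn
  have rpad := rg.trans ((Reach.carry (S := Set.range g) r g fun i => subset_affSpan _ ⟨i, rfl⟩).width
    (W' := d) (by rw [Fintype.card_fin]; omega))
  obtain ⟨φ, hφ, h⟩ := exists_mem_paraClass hU hT hds rpad hin hout
  have hL : T + (n + r) = 42 * (⌊β⌋₊ + 1) ^ 2 * I * Nat.clog 2 (8 * I) + 6 * din * T := by
    rw [← add_assoc, ← hr]
    ring
  rw [hL] at hφ
  refine ⟨φ, hφ, fun X hX i => ?_⟩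
  rw [mul_comm din T]
  exact (h X hX i _ (abs_le.1 (hbd i X hX))).trans (hg i ⟨X, hX⟩)
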